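/- For every d ∈ ℕ there exists a constant c = c(d) > 0 such that for every multilinear polynomial f of degree d on ℝ^N and every t ≥ 0, P_κ(|f − E_κ f| ≥ t) ≤ 2 exp(− c · min_{1≤k≤d} min_{𝓘 ∈ P_k} ( t / (|𝒳|^k ‖E_κ ∇^k f‖_𝓘) )^{2/|𝓘|} ), where |𝓘| is the number of blocks of the partition 𝓘. -/

import Mathlib

open Finset Real
open scoped Classical

noncomputable section

/-- The multislice `Ω_κ ⊆ 𝒳^N`: vectors with values in `{x ℓ}` where the value `x ℓ`
appears exactly `κ ℓ` times. -/
def multislice (L N : ℕ) (κ : Fin L → ℕ) (x : Fin L → ℝ) : Finset (Fin N → ℝ) :=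
  (Fintype.piFinset fun _ : Fin N => Finset.image x Finset.univ).filter
    (fun ω => ∀ ℓ : Fin L, (Finset.univ.filter fun i => ω i = x ℓ).card = κ ℓ)

/-- Expectation with respect to the uniform distribution on a finite set. -/
def uexpect {α : Type*} (Ω : Finset α) (f : α → ℝ) : ℝ := (∑ ω ∈ Ω, f ω) / Ω.card

/-- Probability of an event with respect to the uniform distribution on a finite set. -/
def uprob {α : Type*} (Ω : Finset α) (p : α → Prop) : ℝ :=
  ((Ω.filter p).card : ℝ) / Ω.card

/-- A multilinear polynomial `ω ↦ ∑_S a_S ∏_{i ∈ S} ω_i` given by its coefficients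
`a : Finset (Fin N) → ℝ`. -/
def mlPoly {N : ℕ} (a : Finset (Fin N) → ℝ) (ω : Fin N → ℝ) : ℝ :=
  ∑ S ∈ (Finset.univ : Finset (Fin N)).powerset, a S * ∏ i ∈ S, ω i

/-- The `k`-tensor of `k`-th order partial derivatives of the multilinear polynomial with
coefficients `a`, evaluated at `ω`, at the multi-index `idx`. -/
def mlDeriv {N : ℕ} (a : Finset (Fin N) → ℝ) (k : ℕ) (ω : Fin N → ℝ)
    (idx : Fin k → Fin N) : ℝ :=
  if Function.Injective idx then
    ∑ S ∈ (Finset.univ : Finset (Fin N)).powerset.filter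
        (fun S => Finset.image idx Finset.univ ⊆ S),
      a S * ∏ i ∈ S \ Finset.image idx Finset.univ, ω i
  else 0

/-- The family of tensor norms `‖A‖_𝓘` indexed by partitions `𝓘` of `{1, …, k}`:
the supremum of `∑ A_{i_1…i_k} ∏_ℓ x^{(ℓ)}_{i_{I_ℓ}}` over families of vectors
`x^{(ℓ)}` (indexed by the tuples on the block `I_ℓ`) of Euclidean norm at most one. -/
def tensorNorm {k N : ℕ} (A : (Fin k → Fin N) → ℝ)
    (P : Finpartition (Finset.univ : Finset (Fin k))) : ℝ :=
  sSup { r | ∃ xv : ∀ I : Finset (Fin k), (↥I → Fin N) → ℝ,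
    (∀ I ∈ P.parts, ∑ y : ↥I → Fin N, (xv I y) ^ 2 ≤ 1) ∧
    r = ∑ idx : Fin k → Fin N, A idx * ∏ I ∈ P.parts.attach, xv I.1 (fun m => idx m.1) }

section UniformExpectation

variable {α β : Type*} {Ω : Finset α}

lemma uexpect_mono {f g : α → ℝ} (h : ∀ ω ∈ Ω, f ω ≤ g ω) : uexpect Ω f ≤ uexpect Ω g := by
  unfold uexpect
  gcongr with i hi
  exact h i hi

lemma uexpect_congr {f g : α → ℝ} (h : ∀ ω ∈ Ω, f ω = g ω) : uexpect Ω f = uexpect Ω g := by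
  unfold uexpect
  rw [Finset.sum_congr rfl h]

lemma uexpect_nonneg {f : α → ℝ} (h : ∀ ω ∈ Ω, 0 ≤ f ω) : 0 ≤ uexpect Ω f :=
  div_nonneg (Finset.sum_nonneg h) (Nat.cast_nonneg _)

lemma uexpect_add (f g : α → ℝ) :
    uexpect Ω (fun ω => f ω + g ω) = uexpect Ω f + uexpect Ω g := by
  simp [uexpect, Finset.sum_add_distrib, add_div]

lemma uexpect_sub (f g : α → ℝ) :
    uexpect Ω (fun ω => f ω - g ω) = uexpect Ω f - uexpect Ω g := by
  simp [uexpect, Finset.sum_sub_distrib, sub_div]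

lemma uexpect_const_mul (c : ℝ) (f : α → ℝ) :
    uexpect Ω (fun ω => c * f ω) = c * uexpect Ω f := by
  simp [uexpect, ← Finset.mul_sum, mul_div_assoc]

lemma uexpect_mul_const (c : ℝ) (f : α → ℝ) :
    uexpect Ω (fun ω => f ω * c) = uexpect Ω f * c := by
  simp [uexpect, ← Finset.sum_mul, div_mul_eq_mul_div]

lemma uexpect_sum (s : Finset β) (f : β → α → ℝ) :
    uexpect Ω (fun ω => ∑ b ∈ s, f b ω) = ∑ b ∈ s, uexpect Ω (f b) := by
  simp only [uexpect, ← Finset.sum_div]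
  rw [Finset.sum_comm]

lemma uexpect_const (hΩ : Ω.Nonempty) (c : ℝ) : uexpect Ω (fun _ => c) = c := by
  have : (Ω.card : ℝ) ≠ 0 := by exact_mod_cast hΩ.card_pos.ne'
  simp [uexpect, this]

lemma uexpect_comm (Ω : Finset α) (Ω' : Finset β) (f : α → β → ℝ) :
    uexpect Ω (fun ω => uexpect Ω' (f ω)) = uexpect Ω' fun ω' => uexpect Ω fun ω => f ω ω' := by
  simp only [uexpect, ← Finset.sum_div]
  rw [Finset.sum_comm, div_right_comm]

lemma uexpect_mul_sq_le (f g : α → ℝ) :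
    (uexpect Ω fun ω => f ω * g ω) ^ 2 ≤
      (uexpect Ω fun ω => f ω ^ 2) * uexpect Ω fun ω => g ω ^ 2 := by
  unfold uexpect
  rw [div_pow, div_mul_div_comm, ← sq]
  gcongr
  exact Finset.sum_mul_sq_le_sq_mul_sq _ _ _

/-- Jensen's inequality for powers with respect to a probability density `w`. -/
lemma uexpect_density_mul_pow_le {w f : α → ℝ} (hw : ∀ ω ∈ Ω, 0 ≤ w ω) (hw1 : uexpect Ω w = 1)
    (hf : ∀ ω ∈ Ω, 0 ≤ f ω) (n : ℕ) :
    (uexpect Ω fun ω => w ω * f ω) ^ n ≤ uexpect Ω fun ω => w ω * f ω ^ n := by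
  have h := Real.pow_arith_mean_le_arith_mean_pow Ω (fun ω => w ω / Ω.card) f
    (fun i hi => div_nonneg (hw i hi) (Nat.cast_nonneg _))
    (by rw [← Finset.sum_div]; exact hw1) hf n
  simpa [uexpect, Finset.sum_div, div_mul_eq_mul_div] using h

lemma uexpect_pow_le (hΩ : Ω.Nonempty) {f : α → ℝ} (hf : ∀ ω ∈ Ω, 0 ≤ f ω) (n : ℕ) :
    (uexpect Ω f) ^ n ≤ uexpect Ω fun ω => f ω ^ n := by
  simpa using uexpect_density_mul_pow_le (w := fun _ => 1) (fun _ _ => zero_le_one)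
    (uexpect_const hΩ 1) hf n

lemma pow_mul_pow_le_weighted {x y : ℝ} (hx : 0 ≤ x) (hy : 0 ≤ y) (a b : ℕ) (hab : 0 < a + b) :
    x ^ a * y ^ b ≤ (a * x ^ (a + b) + b * y ^ (a + b)) / (a + b) := by
  have hn : ((a : ℝ) + b) ≠ 0 := by exact_mod_cast hab.ne'
  have h := Real.geom_mean_le_arith_mean2_weighted (w₁ := a / ((a : ℝ) + b))
    (w₂ := b / ((a : ℝ) + b)) (p₁ := x ^ (a + b)) (p₂ := y ^ (a + b)) (by positivity)
    (by positivity) (by positivity) (by positivity) (by field_simp)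
  rw [← Real.rpow_natCast_mul hx, ← Real.rpow_natCast_mul hy] at h
  push_cast at h
  rw [mul_div_cancel₀ _ hn, mul_div_cancel₀ _ hn, Real.rpow_natCast, Real.rpow_natCast] at h
  refine h.trans (le_of_eq ?_)
  ring

/-- Hölder's inequality with natural exponents. -/
lemma uexpect_pow_mul_pow_le {u v : α → ℝ} (hu : ∀ ω ∈ Ω, 0 ≤ u ω)
    (hv : ∀ ω ∈ Ω, 0 ≤ v ω) {a b : ℕ} (hab : 0 < a + b) {X Y : ℝ} (hX : 0 ≤ X) (hY : 0 ≤ Y)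
    (huX : (uexpect Ω fun ω => u ω ^ (a + b)) ≤ X ^ (a + b))
    (hvY : (uexpect Ω fun ω => v ω ^ (a + b)) ≤ Y ^ (a + b)) :
    (uexpect Ω fun ω => u ω ^ a * v ω ^ b) ≤ X ^ a * Y ^ b := by
  have main : ∀ ε : ℝ, 0 < ε →
      (uexpect Ω fun ω => u ω ^ a * v ω ^ b) ≤ (X + ε) ^ a * (Y + ε) ^ b := by
    intro ε hε
    have hX' : 0 < X + ε := by positivity
    have hY' : 0 < Y + ε := by positivity
    have hn : (0 : ℝ) < (a : ℝ) + b := by exact_mod_cast hab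
    have h1 : (uexpect Ω fun ω => u ω ^ a * v ω ^ b) ≤ uexpect Ω fun ω =>
        (X + ε) ^ a * (Y + ε) ^ b * (a / (a + b) / (X + ε) ^ (a + b)) * u ω ^ (a + b) +
        (X + ε) ^ a * (Y + ε) ^ b * (b / (a + b) / (Y + ε) ^ (a + b)) * v ω ^ (a + b) := by
      refine uexpect_mono fun ω hω => ?_
      have h2 := pow_mul_pow_le_weighted (div_nonneg (hu ω hω) hX'.le)
        (div_nonneg (hv ω hω) hY'.le) a b hab
      have h3 : u ω ^ a * v ω ^ b = (X + ε) ^ a * (Y + ε) ^ b *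
          ((u ω / (X + ε)) ^ a * (v ω / (Y + ε)) ^ b) := by
        rw [div_pow, div_pow]; field_simp
      rw [h3]
      refine (mul_le_mul_of_nonneg_left h2 (by positivity)).trans (le_of_eq ?_)
      rw [div_pow, div_pow]
      field_simp
    refine h1.trans ?_
    rw [uexpect_add, uexpect_const_mul, uexpect_const_mul]
    have huX' : (uexpect Ω fun ω => u ω ^ (a + b)) ≤ (X + ε) ^ (a + b) :=
      huX.trans (by gcongr; linarith)
    have hvY' : (uexpect Ω fun ω => v ω ^ (a + b)) ≤ (Y + ε) ^ (a + b) :=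
      hvY.trans (by gcongr; linarith)
    calc _ ≤ (X + ε) ^ a * (Y + ε) ^ b * (a / (a + b) / (X + ε) ^ (a + b)) * (X + ε) ^ (a + b) +
        (X + ε) ^ a * (Y + ε) ^ b * (b / (a + b) / (Y + ε) ^ (a + b)) * (Y + ε) ^ (a + b) := by
          gcongr
      _ = _ := by field_simp
  have hc : Filter.Tendsto (fun ε : ℝ => (X + ε) ^ a * (Y + ε) ^ b) (nhdsWithin 0 (Set.Ioi 0))
      (nhds ((X + 0) ^ a * (Y + 0) ^ b)) :=
    (Continuous.tendsto (by fun_prop) 0).mono_left nhdsWithin_le_nhds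
  simp only [add_zero] at hc
  exact ge_of_tendsto hc (Filter.eventually_of_mem self_mem_nhdsWithin fun ε hε => main ε hε)

/-- The `L^m` norm of a nonnegative function under the uniform distribution on `Ω`. -/
def ulpNorm (Ω : Finset α) (m : ℕ) (f : α → ℝ) : ℝ :=
  (uexpect Ω fun ω => f ω ^ m) ^ ((m : ℝ)⁻¹)

lemma ulpNorm_nonneg {m : ℕ} {f : α → ℝ} (hf : ∀ ω ∈ Ω, 0 ≤ f ω) : 0 ≤ ulpNorm Ω m f :=
  Real.rpow_nonneg (uexpect_nonneg fun ω hω => pow_nonneg (hf ω hω) _) _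

lemma ulpNorm_pow {m : ℕ} (hm : m ≠ 0) {f : α → ℝ} (hf : ∀ ω ∈ Ω, 0 ≤ f ω) :
    ulpNorm Ω m f ^ m = uexpect Ω fun ω => f ω ^ m :=
  Real.rpow_inv_natCast_pow (uexpect_nonneg fun ω hω => pow_nonneg (hf ω hω) _) hm

lemma ulpNorm_mono_exponent (hΩ : Ω.Nonempty) {m n : ℕ} (hm : m ≠ 0) (hmn : m ≤ n) {f : α → ℝ}
    (hf : ∀ ω ∈ Ω, 0 ≤ f ω) : ulpNorm Ω m f ≤ ulpNorm Ω n f := by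
  obtain ⟨b, rfl⟩ := Nat.exists_eq_add_of_le hmn
  have hn : m + b ≠ 0 := by omega
  have h := uexpect_pow_mul_pow_le hf (v := fun _ => 1) (fun _ _ => zero_le_one)
    (a := m) (b := b) (by omega) (ulpNorm_nonneg (m := m + b) hf) zero_le_one
    (ulpNorm_pow hn hf).ge (by simp [uexpect_const hΩ])
  simp only [one_pow, mul_one] at h
  rw [← ulpNorm_pow hm hf] at h
  exact le_of_pow_le_pow_left₀ hm (ulpNorm_nonneg hf) h

end UniformExpectation

section SymmetricGroup

variable {α : Type*}

lemma pow_sub_pow_le_mul_max {u v : ℝ} (hu : 0 ≤ u) (hv : 0 ≤ v) (m : ℕ) :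
    u ^ (m + 1) - v ^ (m + 1) ≤ (m + 1) * (u ^ m * max (u - v) 0) := by
  rcases le_total v u with h | h
  · rw [max_eq_left (by linarith), ← geom_sum₂_mul]
    have : ∑ i ∈ Finset.range (m + 1), u ^ i * v ^ (m + 1 - 1 - i) ≤
        ∑ i ∈ Finset.range (m + 1), u ^ m := by
      refine Finset.sum_le_sum fun i hi => ?_
      have hi' : i ≤ m := by simpa [Nat.lt_succ_iff] using hi
      calc u ^ i * v ^ (m + 1 - 1 - i) ≤ u ^ i * u ^ (m - i) := by
            simp only [Nat.add_sub_cancel]; gcongr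
        _ = u ^ m := by rw [← pow_add]; congr 1; omega
    simp only [Finset.sum_const, Finset.card_range, nsmul_eq_mul] at this
    push_cast at this
    exact (mul_le_mul_of_nonneg_right this (sub_nonneg.2 h)).trans (le_of_eq (by ring))
  · have h1 : u ^ (m + 1) ≤ v ^ (m + 1) := by gcongr
    have h2 : 0 ≤ (m + 1) * (u ^ m * max (u - v) 0) := by positivity
    linarith

lemma ulpNorm_increment_le_of_le {Ω : Finset α} (hΩ : Ω.Nonempty) {u v : α → ℝ}
    (hu : ∀ ω ∈ Ω, 0 ≤ u ω) (hv : ∀ ω ∈ Ω, 0 ≤ v ω) (m : ℕ)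
    (huv : ulpNorm Ω (m + 1) v ≤ ulpNorm Ω (m + 1) u) :
    (ulpNorm Ω (m + 1) u ^ (m + 1) - ulpNorm Ω (m + 1) v ^ (m + 1)) *
        (ulpNorm Ω (m + 1) u - ulpNorm Ω (m + 1) v) ≤
      (m + 1) * uexpect Ω fun ω => u ω ^ m * max (u ω - v ω) 0 ^ 2 := by
  set a := ulpNorm Ω (m + 1) u with ha
  set b := ulpNorm Ω (m + 1) v with hb
  have hb0 : 0 ≤ b := ulpNorm_nonneg hv
  have ha0 : 0 ≤ a := hb0.trans huv
  have haE : a ^ (m + 1) = uexpect Ω fun ω => u ω ^ (m + 1) := ulpNorm_pow (by omega) hu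
  have hbE : b ^ (m + 1) = uexpect Ω fun ω => v ω ^ (m + 1) := ulpNorm_pow (by omega) hv
  set R := uexpect Ω fun ω => u ω ^ m * max (u ω - v ω) 0 ^ 2 with hR
  have hR0 : 0 ≤ R := uexpect_nonneg fun ω hω => by have := hu ω hω; positivity
  rcases ha0.eq_or_lt with h0 | hapos
  · have : b = 0 := le_antisymm (h0 ▸ huv) hb0
    rw [← h0, this]; simp; positivity
  set Q := uexpect Ω fun ω => u ω ^ m * max (u ω - v ω) 0 with hQ
  have h1 : a ^ (m + 1) - b ^ (m + 1) ≤ (m + 1) * Q := by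
    rw [haE, hbE, ← uexpect_sub, hQ, ← uexpect_const_mul]
    exact uexpect_mono fun ω hω => pow_sub_pow_le_mul_max (hu ω hω) (hv ω hω) m
  have h2 : a ^ m * (a - b) ≤ Q := by
    have h3 := uexpect_pow_mul_pow_le hu hv (a := m) (b := 1) (by omega) ha0 hb0 haE.ge hbE.ge
    have h4 : (uexpect Ω fun ω => u ω ^ (m + 1)) - (uexpect Ω fun ω => u ω ^ m * v ω ^ 1) ≤ Q := by
      rw [← uexpect_sub]
      refine uexpect_mono fun ω hω => ?_
      have := mul_le_mul_of_nonneg_left (le_max_left (u ω - v ω) 0) (pow_nonneg (hu ω hω) m)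
      calc _ = u ω ^ m * (u ω - v ω) := by ring
        _ ≤ _ := this
    rw [← haE] at h4
    calc a ^ m * (a - b) = a ^ (m + 1) - a ^ m * b ^ 1 := by ring
      _ ≤ Q := by linarith
  have h5 : Q ^ 2 ≤ a ^ m * R := by
    have h6 := uexpect_mul_sq_le (Ω := Ω) (fun ω => √(u ω ^ m))
      (fun ω => √(u ω ^ m) * max (u ω - v ω) 0)
    have e1 : (uexpect Ω fun ω => √(u ω ^ m) * (√(u ω ^ m) * max (u ω - v ω) 0)) = Q :=
      uexpect_congr fun ω hω => by
        rw [← mul_assoc, Real.mul_self_sqrt (pow_nonneg (hu ω hω) m)]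
    have e2 : (uexpect Ω fun ω => √(u ω ^ m) ^ 2) = uexpect Ω fun ω => u ω ^ m * 1 ^ 1 :=
      uexpect_congr fun ω hω => by rw [Real.sq_sqrt (pow_nonneg (hu ω hω) m)]; simp
    have e3 : (uexpect Ω fun ω => (√(u ω ^ m) * max (u ω - v ω) 0) ^ 2) = R :=
      uexpect_congr fun ω hω => by rw [mul_pow, Real.sq_sqrt (pow_nonneg (hu ω hω) m)]
    rw [e1, e2, e3] at h6
    have h7 := uexpect_pow_mul_pow_le hu (v := fun _ => 1) (fun _ _ => zero_le_one) (a := m)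
      (b := 1) (by omega) ha0 zero_le_one haE.ge (by simp [uexpect_const hΩ])
    refine h6.trans (mul_le_mul_of_nonneg_right (h7.trans (by simp)) hR0)
  have hQ0 : 0 ≤ Q := le_trans (mul_nonneg (by positivity) (by linarith)) h2
  have h8 : a ^ m * ((a ^ (m + 1) - b ^ (m + 1)) * (a - b)) ≤ a ^ m * ((m + 1) * R) := by
    calc a ^ m * ((a ^ (m + 1) - b ^ (m + 1)) * (a - b))
        = (a ^ (m + 1) - b ^ (m + 1)) * (a ^ m * (a - b)) := by ring
      _ ≤ ((m + 1) * Q) * Q := by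
          gcongr
      _ = (m + 1) * Q ^ 2 := by ring
      _ ≤ (m + 1) * (a ^ m * R) := by gcongr
      _ = _ := by ring
  exact le_of_mul_le_mul_left h8 (by positivity)

lemma ulpNorm_increment_le {Ω : Finset α} (hΩ : Ω.Nonempty) {u v : α → ℝ}
    (hu : ∀ ω ∈ Ω, 0 ≤ u ω) (hv : ∀ ω ∈ Ω, 0 ≤ v ω) (m : ℕ) :
    (ulpNorm Ω (m + 1) u ^ (m + 1) - ulpNorm Ω (m + 1) v ^ (m + 1)) *
        (ulpNorm Ω (m + 1) u - ulpNorm Ω (m + 1) v) ≤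
      (m + 1) * ((uexpect Ω fun ω => u ω ^ m * max (u ω - v ω) 0 ^ 2) +
        uexpect Ω fun ω => v ω ^ m * max (v ω - u ω) 0 ^ 2) := by
  have p1 : 0 ≤ uexpect Ω fun ω => u ω ^ m * max (u ω - v ω) 0 ^ 2 :=
    uexpect_nonneg fun ω hω => by have := hu ω hω; positivity
  have p2 : 0 ≤ uexpect Ω fun ω => v ω ^ m * max (v ω - u ω) 0 ^ 2 :=
    uexpect_nonneg fun ω hω => by have := hv ω hω; positivity
  have hm : (0 : ℝ) ≤ m + 1 := by positivity
  rcases le_total (ulpNorm Ω (m + 1) v) (ulpNorm Ω (m + 1) u) with h | h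
  · refine (ulpNorm_increment_le_of_le hΩ hu hv m h).trans ?_
    gcongr; linarith
  · have := ulpNorm_increment_le_of_le hΩ hv hu m h
    nlinarith

end SymmetricGroup

section PermutationEntropy

variable {α : Type*} [DecidableEq α]

/-- The integrand of the Dirichlet form controlling the entropy of order `m + 1`. -/
def swapEnergy (m : ℕ) (f : Equiv.Perm α → ℝ) (i j : α) (τ : Equiv.Perm α) : ℝ :=
  f τ ^ m * max (f τ - f (Equiv.swap i j * τ)) 0 ^ 2

lemma swapEnergy_self (m : ℕ) (f : Equiv.Perm α → ℝ) (i : α) (τ : Equiv.Perm α) :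
    swapEnergy m f i i τ = 0 := by
  simp [swapEnergy, ← Equiv.Perm.one_def]

lemma swapEnergy_nonneg (m : ℕ) {f : Equiv.Perm α → ℝ} (hf : ∀ τ, 0 ≤ f τ) (i j : α)
    (τ : Equiv.Perm α) : 0 ≤ swapEnergy m f i j τ :=
  mul_nonneg (pow_nonneg (hf τ) _) (sq_nonneg _)

section Fibers

variable {Ω : Finset (Equiv.Perm α)} {V : Finset α} {a : α}

lemma uexpect_fiber_swap (hswap : ∀ i ∈ V, ∀ j ∈ V, ∀ τ ∈ Ω, Equiv.swap i j * τ ∈ Ω)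
    {p p' : α} (hp : p ∈ V) (hp' : p' ∈ V) (g : Equiv.Perm α → ℝ) :
    (Ω.filter fun τ => τ a = p').card = (Ω.filter fun τ => τ a = p).card ∧
    uexpect (Ω.filter fun τ => τ a = p') g =
      uexpect (Ω.filter fun τ => τ a = p) fun τ => g (Equiv.swap p p' * τ) := by
  have hcard : (Ω.filter fun τ => τ a = p').card = (Ω.filter fun τ => τ a = p).card := by
    refine (Finset.card_nbij' (fun τ => Equiv.swap p p' * τ) (fun τ => Equiv.swap p p' * τ)
      ?_ ?_ ?_ ?_).symm
    · intro τ hτ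
      simp only [Finset.coe_filter, Set.mem_ofPred_eq, Equiv.Perm.mul_apply] at hτ ⊢
      exact ⟨hswap _ hp _ hp' _ hτ.1, by rw [hτ.2, Equiv.swap_apply_left]⟩
    · intro τ hτ
      simp only [Finset.coe_filter, Set.mem_ofPred_eq, Equiv.Perm.mul_apply] at hτ ⊢
      exact ⟨hswap _ hp _ hp' _ hτ.1, by rw [hτ.2, Equiv.swap_apply_right]⟩
    · intro τ _; simp [← mul_assoc]
    · intro τ _; simp [← mul_assoc]
  refine ⟨hcard, ?_⟩
  unfold uexpect
  rw [hcard]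
  congr 1
  refine Finset.sum_nbij' (fun τ => Equiv.swap p p' * τ) (fun τ => Equiv.swap p p' * τ)
      ?_ ?_ ?_ ?_ ?_
  · intro τ hτ
    simp only [Finset.mem_filter, Equiv.Perm.mul_apply] at hτ ⊢
    exact ⟨hswap _ hp _ hp' _ hτ.1, by rw [hτ.2, Equiv.swap_apply_right]⟩
  · intro τ hτ
    simp only [Finset.mem_filter, Equiv.Perm.mul_apply] at hτ ⊢
    exact ⟨hswap _ hp _ hp' _ hτ.1, by rw [hτ.2, Equiv.swap_apply_left]⟩
  · intro τ _; simp [← mul_assoc]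
  · intro τ _; simp [← mul_assoc]
  · intro τ _; simp [← mul_assoc]

lemma fiber_nonempty (hΩ : Ω.Nonempty) (hV : ∀ τ ∈ Ω, τ a ∈ V)
    (hswap : ∀ i ∈ V, ∀ j ∈ V, ∀ τ ∈ Ω, Equiv.swap i j * τ ∈ Ω) {p : α} (hp : p ∈ V) :
    (Ω.filter fun τ => τ a = p).Nonempty := by
  obtain ⟨τ, hτ⟩ := hΩ
  exact ⟨Equiv.swap (τ a) p * τ, by simp [hswap _ (hV τ hτ) _ hp _ hτ]⟩

lemma uexpect_eq_uexpect_fiber (hΩ : Ω.Nonempty) (hV : ∀ τ ∈ Ω, τ a ∈ V)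
    (hswap : ∀ i ∈ V, ∀ j ∈ V, ∀ τ ∈ Ω, Equiv.swap i j * τ ∈ Ω) (g : Equiv.Perm α → ℝ) :
    uexpect Ω g = uexpect V fun p => uexpect (Ω.filter fun τ => τ a = p) g := by
  obtain ⟨τ₀, hτ₀⟩ := hΩ
  set c := (Ω.filter fun τ => τ a = τ₀ a).card with hc
  have hcard : ∀ p ∈ V, (Ω.filter fun τ => τ a = p).card = c := fun p hp =>
    (uexpect_fiber_swap hswap (hV _ hτ₀) hp (fun _ => 0)).1
  have hΩc : (Ω.card : ℝ) = V.card * c := by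
    rw [Finset.card_eq_sum_card_fiberwise (f := fun τ => τ a) (t := V) (fun τ hτ => hV τ hτ),
      Finset.sum_congr rfl hcard]
    simp
  have hsum : ∑ τ ∈ Ω, g τ = ∑ p ∈ V, ∑ τ ∈ Ω.filter fun τ => τ a = p, g τ :=
    (Finset.sum_fiberwise_of_maps_to (fun τ hτ => hV τ hτ) g).symm
  unfold uexpect
  rw [hsum, hΩc, mul_comm, ← div_div, Finset.sum_div]
  congr 1
  exact Finset.sum_congr rfl fun p hp => by
    beta_reduce
    rw [hcard p hp]

lemma entropy_fiber_step (m : ℕ) {f : Equiv.Perm α → ℝ} (hf : ∀ τ, 0 ≤ f τ) (hΩ : Ω.Nonempty)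
    (hV : ∀ τ ∈ Ω, τ a ∈ V)
    (hswap : ∀ i ∈ V, ∀ j ∈ V, ∀ τ ∈ Ω, Equiv.swap i j * τ ∈ Ω) :
    (uexpect Ω fun τ => f τ ^ (m + 2)) - ulpNorm Ω (m + 1) f ^ (m + 2) ≤
      (uexpect V fun p => (uexpect (Ω.filter fun τ => τ a = p) fun τ => f τ ^ (m + 2)) -
        ulpNorm (Ω.filter fun τ => τ a = p) (m + 1) f ^ (m + 2)) +
      (m + 1) * uexpect Ω fun τ => uexpect V fun p => swapEnergy m f (τ a) p τ := by
  have hVne : V.Nonempty := by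
    obtain ⟨τ, hτ⟩ := hΩ
    exact ⟨_, hV τ hτ⟩
  set T : α → Finset (Equiv.Perm α) := fun p => Ω.filter fun τ => τ a = p with hT
  set b : α → ℝ := fun p => ulpNorm (T p) (m + 1) f with hb
  set X : α → α → ℝ := fun p p' => uexpect (T p) (swapEnergy m f p p') with hX
  have hfT : ∀ (Ω' : Finset (Equiv.Perm α)), ∀ τ ∈ Ω', 0 ≤ f τ := fun _ τ _ => hf τ
  have hb0 : ∀ p, 0 ≤ b p := fun p => ulpNorm_nonneg (hfT _)
  have htot := uexpect_eq_uexpect_fiber hΩ hV hswap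
  have hnorm : ulpNorm Ω (m + 1) f ^ (m + 1) = uexpect V fun p => b p ^ (m + 1) := by
    rw [ulpNorm_pow (by omega) (hfT _), htot]
    exact uexpect_congr fun p _ => (ulpNorm_pow (by omega) (hfT _)).symm
  have hmean : uexpect V b ≤ ulpNorm Ω (m + 1) f := by
    refine le_of_pow_le_pow_left₀ (n := m + 1) (by omega) (ulpNorm_nonneg (hfT _)) ?_
    rw [hnorm]
    exact uexpect_pow_le hVne (fun p _ => hb0 p) _
  have hcov : (uexpect V fun p => b p ^ (m + 2)) -
      (uexpect V fun p => b p ^ (m + 1)) * uexpect V b =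
      uexpect V fun p => uexpect V fun p' =>
        1 / 2 * ((b p ^ (m + 1) - b p' ^ (m + 1)) * (b p - b p')) := by
    have e : ∀ p p', 1 / 2 * ((b p ^ (m + 1) - b p' ^ (m + 1)) * (b p - b p')) =
        (1 / 2 * b p ^ (m + 2) + 1 / 2 * b p' ^ (m + 2)) -
        (1 / 2 * b p ^ (m + 1) * b p' + 1 / 2 * b p * b p' ^ (m + 1)) := fun p p' => by ring
    simp only [e]
    simp only [uexpect_sub, uexpect_add, uexpect_const_mul, uexpect_mul_const, uexpect_const hVne]
    ring
  have hinc : ∀ p ∈ V, ∀ p' ∈ V, (b p ^ (m + 1) - b p' ^ (m + 1)) * (b p - b p') ≤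
      (m + 1) * (X p p' + X p' p) := by
    intro p hp p' hp'
    have h := ulpNorm_increment_le (fiber_nonempty hΩ hV hswap hp) (u := f)
      (v := fun τ => f (Equiv.swap p p' * τ)) (hfT _) (fun τ _ => hf _) m
    have e1 : ulpNorm (T p) (m + 1) (fun τ => f (Equiv.swap p p' * τ)) = b p' := by
      simp only [hb, ulpNorm]
      rw [(uexpect_fiber_swap hswap hp hp' _).2]
    have e2 : X p' p = uexpect (T p) fun τ => f (Equiv.swap p p' * τ) ^ m *
        max (f (Equiv.swap p p' * τ) - f τ) 0 ^ 2 := by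
      simp only [hX]
      rw [(uexpect_fiber_swap hswap hp hp' _).2]
      refine uexpect_congr fun τ _ => ?_
      simp only [swapEnergy]
      rw [Equiv.swap_comm p' p, ← mul_assoc (Equiv.swap p p'), Equiv.swap_mul_self, one_mul]
    change (b p ^ (m + 1) - _ ^ (m + 1)) * (b p - _) ≤ _ at h
    rw [e1] at h
    rw [e2]
    exact h
  have hlast : (uexpect Ω fun τ => uexpect V fun p => swapEnergy m f (τ a) p τ) =
      uexpect V fun p => uexpect V fun p' => X p p' := by
    rw [htot]
    refine uexpect_congr fun p _ => ?_
    rw [uexpect_comm]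
    refine uexpect_congr fun p' _ => uexpect_congr fun τ hτ => ?_
    rw [(Finset.mem_filter.1 hτ).2]
  have hsym : (uexpect V fun p => uexpect V fun p' => X p' p) =
      uexpect V fun p => uexpect V fun p' => X p p' := uexpect_comm _ _ _
  have hub : (uexpect V fun p => b p ^ (m + 2)) -
      (uexpect V fun p => b p ^ (m + 1)) * uexpect V b ≤
      (m + 1) * uexpect V fun p => uexpect V fun p' => X p p' := by
    rw [hcov]
    calc _ ≤ uexpect V fun p => uexpect V fun p' => 1 / 2 * ((m + 1) * (X p p' + X p' p)) :=
          uexpect_mono fun p hp => uexpect_mono fun p' hp' =>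
            mul_le_mul_of_nonneg_left (hinc p hp p' hp') (by norm_num)
      _ = _ := by
          simp only [uexpect_const_mul, uexpect_add, hsym]
          ring
  rw [htot (fun τ => f τ ^ (m + 2)), uexpect_sub, hlast]
  have hpow : ulpNorm Ω (m + 1) f ^ (m + 2) ≥
      (uexpect V fun p => b p ^ (m + 1)) * uexpect V b := by
    rw [pow_succ, hnorm]
    exact mul_le_mul_of_nonneg_left hmean (uexpect_nonneg fun p _ => pow_nonneg (hb0 p) _)
  change _ ≤ _ - (uexpect V fun p => b p ^ (m + 2)) + _
  linarith

end Fibers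

lemma sum_erase_erase_sum {V : Finset α} {G : α → α → ℝ} (hG : ∀ i, G i i = 0) :
    ∑ p ∈ V, ∑ i ∈ V.erase p, ∑ j ∈ V.erase p, G i j =
      ((V.card : ℝ) - 2) * ∑ i ∈ V, ∑ j ∈ V, G i j := by
  have h : ∀ p ∈ V, ∑ i ∈ V.erase p, ∑ j ∈ V.erase p, G i j =
      ∑ i ∈ V, ∑ j ∈ V, G i j - ∑ i ∈ V, G i p - ∑ j ∈ V, G p j := by
    intro p hp
    have h1 : ∀ i, ∑ j ∈ V.erase p, G i j = ∑ j ∈ V, G i j - G i p := fun i => by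
      rw [← Finset.sum_erase_add _ _ hp]; ring
    simp only [h1, Finset.sum_sub_distrib]
    rw [← Finset.sum_erase_add _ (fun i => ∑ j ∈ V, G i j) hp,
      ← Finset.sum_erase_add _ (fun i => G i p) hp, hG]
    ring
  rw [Finset.sum_congr rfl h]
  simp only [Finset.sum_sub_distrib, Finset.sum_const, nsmul_eq_mul]
  rw [Finset.sum_comm (f := fun p i => G i p)]
  ring

variable [Fintype α]

/-- The permutations agreeing with `σ` on `A`. -/
def permSlice (A : Finset α) (σ : Equiv.Perm α) : Finset (Equiv.Perm α) :=
  Finset.univ.filter fun τ => ∀ x ∈ A, τ x = σ x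

lemma mem_permSlice {A : Finset α} {σ τ : Equiv.Perm α} :
    τ ∈ permSlice A σ ↔ ∀ x ∈ A, τ x = σ x := by
  simp [permSlice]

lemma perm_image_compl (A : Finset α) (τ : Equiv.Perm α) : Aᶜ.image τ = (A.image τ)ᶜ := by
  ext y
  simp only [Finset.mem_image, Finset.mem_compl, not_exists, not_and]
  constructor
  · rintro ⟨x, hx, rfl⟩ z hz h
    exact hx (τ.injective h ▸ hz)
  · intro h
    exact ⟨τ.symm y, fun hy => h _ hy (by simp), by simp⟩

lemma permSlice_image {A : Finset α} {σ τ : Equiv.Perm α} (h : τ ∈ permSlice A σ) :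
    Aᶜ.image τ = Aᶜ.image σ := by
  rw [mem_permSlice] at h
  rw [perm_image_compl, perm_image_compl, Finset.image_congr fun x hx => h x hx]

lemma permSlice_filter {A : Finset α} {σ : Equiv.Perm α} {a p : α} (ha : a ∉ A)
    (hp : p ∈ Aᶜ.image σ) :
    (permSlice A σ).filter (fun τ => τ a = p) =
      permSlice (insert a A) (Equiv.swap p (σ a) * σ) ∧
    (insert a A)ᶜ.image (Equiv.swap p (σ a) * σ) = (Aᶜ.image σ).erase p := by
  have hA : ∀ x ∈ A, (Equiv.swap p (σ a) * σ) x = σ x := by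
    intro x hx
    rw [Equiv.Perm.mul_apply, Equiv.swap_apply_of_ne_of_ne]
    · rintro rfl
      simp [hx] at hp
    · intro h
      exact ha (σ.injective h ▸ hx)
  constructor
  · ext τ
    simp only [Finset.mem_filter, mem_permSlice, Finset.forall_mem_insert]
    rw [and_comm, Equiv.Perm.mul_apply, Equiv.swap_apply_right]
    refine and_congr_right fun _ => forall₂_congr fun x hx => ?_
    rw [hA x hx]
  · rw [perm_image_compl, Finset.image_insert, Finset.image_congr fun x hx => hA x hx,
      Finset.compl_insert, ← perm_image_compl, Equiv.Perm.mul_apply, Equiv.swap_apply_right]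

lemma permSlice_entropy (m : ℕ) {f : Equiv.Perm α → ℝ} (hf : ∀ τ, 0 ≤ f τ) (n : ℕ) :
    ∀ (A : Finset α) (σ : Equiv.Perm α), Aᶜ.card = n →
    (uexpect (permSlice A σ) fun τ => f τ ^ (m + 2)) -
        ulpNorm (permSlice A σ) (m + 1) f ^ (m + 2) ≤
      (m + 1) / n * uexpect (permSlice A σ) fun τ => ∑ i ∈ Aᶜ.image σ, ∑ j ∈ Aᶜ.image σ,
        swapEnergy m f i j τ := by
  induction n with
  | zero =>
    intro A σ hA
    have hA' : A = Finset.univ := by simpa using hA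
    subst hA'
    have hs : permSlice Finset.univ σ = {σ} := by
      ext τ
      simp [mem_permSlice, Equiv.ext_iff]
    have h1 : ulpNorm {σ} (m + 1) f = f σ := by
      refine (pow_left_inj₀ (ulpNorm_nonneg fun τ _ => hf τ) (hf σ) (n := m + 1) (by omega)).1 ?_
      rw [ulpNorm_pow (by omega) fun τ _ => hf τ]
      simp [uexpect]
    rw [hs, h1]
    simp [uexpect]
  | succ k ih =>
    intro A σ hA
    set V := Aᶜ.image σ with hVdef
    set Ω := permSlice A σ with hΩdef
    have hVcard : V.card = k + 1 := by
      rw [hVdef, Finset.card_image_of_injective _ σ.injective, hA]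
    have hΩ : Ω.Nonempty := ⟨σ, mem_permSlice.2 fun _ _ => rfl⟩
    have hV : ∀ a ∈ Aᶜ, ∀ τ ∈ Ω, τ a ∈ V := fun a ha τ hτ => by
      rw [hVdef, ← permSlice_image hτ]
      exact Finset.mem_image_of_mem _ ha
    have hswap : ∀ i ∈ V, ∀ j ∈ V, ∀ τ ∈ Ω, Equiv.swap i j * τ ∈ Ω := by
      intro i hi j hj τ hτ
      have hn : ∀ v ∈ V, ∀ x ∈ A, σ x ≠ v := by
        rintro v hv x hx rfl
        simp [hVdef, hx] at hv
      rw [hΩdef, mem_permSlice] at hτ ⊢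
      intro x hx
      rw [Equiv.Perm.mul_apply, hτ x hx, Equiv.swap_apply_of_ne_of_ne (hn i hi x hx) (hn j hj x hx)]
    set D := (uexpect Ω fun τ => f τ ^ (m + 2)) - ulpNorm Ω (m + 1) f ^ (m + 2) with hD
    set G : Equiv.Perm α → α → α → ℝ := fun τ i j => swapEnergy m f i j τ with hG
    have hstep : ∀ a ∈ Aᶜ, D ≤ uexpect Ω fun τ =>
        (m + 1) / k * (∑ i ∈ V.erase (τ a), ∑ j ∈ V.erase (τ a), G τ i j) +
        (m + 1) / (k + 1) * ∑ p ∈ V, G τ (τ a) p := by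
      intro a ha
      refine (entropy_fiber_step m hf hΩ (hV a ha) hswap).trans ?_
      rw [uexpect_add]
      refine add_le_add ?_ (le_of_eq ?_)
      · rw [uexpect_eq_uexpect_fiber hΩ (hV a ha) hswap]
        refine uexpect_mono fun p hp => ?_
        obtain ⟨e1, e2⟩ := permSlice_filter (by simpa using ha) hp
        have h := ih (insert a A) (Equiv.swap p (σ a) * σ) (by
          rw [Finset.compl_insert, Finset.card_erase_of_mem ha, hA]; rfl)
        rw [e2, ← e1] at h
        refine h.trans (le_of_eq ?_)
        rw [← uexpect_const_mul]
        refine uexpect_congr fun τ hτ => ?_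
        rw [(Finset.mem_filter.1 hτ).2]
      · rw [← uexpect_const_mul]
        refine uexpect_congr fun τ _ => ?_
        simp only [uexpect, hVcard]
        push_cast
        ring
    have hsum : (k + 1) * D ≤ uexpect Ω fun τ =>
        ((m + 1) / k * ((k : ℝ) - 1) + (m + 1) / (k + 1)) * ∑ i ∈ V, ∑ j ∈ V, G τ i j := by
      have h1 : ∑ a ∈ Aᶜ, D = (k + 1) * D := by
        rw [Finset.sum_const, hA, nsmul_eq_mul]; push_cast; rfl
      rw [← h1]
      refine (Finset.sum_le_sum hstep).trans (le_of_eq ?_)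
      rw [← uexpect_sum]
      refine uexpect_congr fun τ hτ => ?_
      rw [← Finset.sum_image (s := Aᶜ) (g := τ)
        (f := fun v => (m + 1) / k * (∑ i ∈ V.erase v, ∑ j ∈ V.erase v, G τ i j) +
          (m + 1) / (k + 1) * ∑ p ∈ V, G τ v p) τ.injective.injOn, permSlice_image hτ,
        Finset.sum_add_distrib, ← Finset.mul_sum, ← Finset.mul_sum,
        sum_erase_erase_sum (fun i => swapEnergy_self m f i τ), hVcard]
      push_cast
      ring
    rw [uexpect_const_mul] at hsum
    set E := uexpect Ω fun τ => ∑ i ∈ V, ∑ j ∈ V, G τ i j with hE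
    have hE0 : 0 ≤ E := uexpect_nonneg fun τ _ => Finset.sum_nonneg fun i _ =>
      Finset.sum_nonneg fun j _ => swapEnergy_nonneg m hf i j τ
    have hc : (m + 1) / k * ((k : ℝ) - 1) + (m + 1) / (k + 1) ≤ (m : ℝ) + 1 := by
      rcases Nat.eq_zero_or_pos k with rfl | hk
      · simp
      · have hk' : (0 : ℝ) < k := by exact_mod_cast hk
        rw [div_mul_eq_mul_div, div_add_div _ _ hk'.ne' (by positivity),
          div_le_iff₀ (by positivity)]
        have hm : (0 : ℝ) ≤ m := Nat.cast_nonneg m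
        nlinarith
    have hk1 : (0 : ℝ) < k + 1 := by positivity
    have : (k + 1) * D ≤ (m + 1) * E := hsum.trans (mul_le_mul_of_nonneg_right hc hE0)
    push_cast
    rw [div_mul_eq_mul_div, le_div_iff₀ hk1]
    linarith

/-- Entropy inequality for the transposition walk on the symmetric group. -/
lemma perm_entropy (m : ℕ) {f : Equiv.Perm α → ℝ} (hf : ∀ τ, 0 ≤ f τ) :
    (uexpect Finset.univ fun τ => f τ ^ (m + 2)) - ulpNorm Finset.univ (m + 1) f ^ (m + 2) ≤
      (m + 1) / Fintype.card α * uexpect Finset.univ fun τ => ∑ i, ∑ j, swapEnergy m f i j τ := by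
  have h := permSlice_entropy m hf (Fintype.card α) ∅ 1 (by simp)
  have e : permSlice (∅ : Finset α) 1 = Finset.univ := by
    ext; simp [mem_permSlice]
  rw [e] at h
  simpa using h

end PermutationEntropy

section PermutationMoments

variable {α : Type*} [DecidableEq α] [Fintype α]

/-- The squared length of the discrete gradient along transpositions. -/
def swapGradSq (F : Equiv.Perm α → ℝ) (τ : Equiv.Perm α) : ℝ :=
  (∑ i, ∑ j, (F τ - F (Equiv.swap i j * τ)) ^ 2) / Fintype.card α

lemma swapGradSq_nonneg (F : Equiv.Perm α → ℝ) (τ : Equiv.Perm α) : 0 ≤ swapGradSq F τ := by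
  unfold swapGradSq
  positivity

lemma perm_entropy_grad (m : ℕ) (F f : Equiv.Perm α → ℝ) (hf : ∀ τ, 0 ≤ f τ)
    (hfF : ∀ τ τ', |f τ - f τ'| ≤ |F τ - F τ'|) :
    (uexpect Finset.univ fun τ => f τ ^ (m + 2)) - ulpNorm Finset.univ (m + 1) f ^ (m + 2) ≤
      (m + 1) * uexpect Finset.univ fun τ => f τ ^ m * swapGradSq F τ := by
  refine (perm_entropy m hf).trans ?_
  rw [div_mul_eq_mul_div, mul_div_assoc]
  refine mul_le_mul_of_nonneg_left ?_ (by positivity)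
  rw [div_eq_inv_mul, ← uexpect_const_mul]
  refine uexpect_mono fun τ _ => ?_
  unfold swapGradSq
  rw [div_eq_inv_mul, mul_left_comm]
  refine mul_le_mul_of_nonneg_left ?_ (by positivity)
  rw [Finset.mul_sum]
  refine Finset.sum_le_sum fun i _ => ?_
  rw [Finset.mul_sum]
  refine Finset.sum_le_sum fun j _ => ?_
  refine mul_le_mul_of_nonneg_left ?_ (pow_nonneg (hf τ) m)
  rw [← sq_abs (F τ - _)]
  refine pow_le_pow_left₀ (le_max_right _ _) ?_ 2
  exact max_le ((le_abs_self _).trans (hfF _ _)) (abs_nonneg _)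

lemma perm_variance_le {F : Equiv.Perm α → ℝ} (hF : uexpect Finset.univ F = 0) :
    (uexpect Finset.univ fun τ => F τ ^ 2) ≤ uexpect Finset.univ (swapGradSq F) := by
  obtain ⟨c, hc⟩ : ∃ c : ℝ, ∀ τ, 0 ≤ F τ + c := by
    refine ⟨∑ τ, |F τ|, fun τ => ?_⟩
    have := Finset.single_le_sum (f := fun τ => |F τ|) (fun τ _ => abs_nonneg _)
      (Finset.mem_univ τ)
    have h2 := neg_abs_le (F τ)
    linarith
  have h := perm_entropy_grad 0 F (fun τ => F τ + c) hc (fun τ τ' => by simp)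
  have hne : (Finset.univ : Finset (Equiv.Perm α)).Nonempty := ⟨1, Finset.mem_univ _⟩
  have e1 : ulpNorm Finset.univ (0 + 1) (fun τ => F τ + c) = c := by
    rw [← pow_one (ulpNorm _ _ _)]
    refine (ulpNorm_pow (m := 0 + 1) (by norm_num) fun τ _ => hc τ).trans ?_
    simp only [zero_add, pow_one]
    rw [uexpect_add, hF, uexpect_const hne, zero_add]
  rw [e1] at h
  have e2 : (uexpect Finset.univ fun τ => (F τ + c) ^ (0 + 2)) =
      (uexpect Finset.univ fun τ => F τ ^ 2) + c ^ 2 := by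
    have : ∀ τ, (F τ + c) ^ (0 + 2) = F τ ^ 2 + (2 * c) * F τ + c ^ 2 := fun τ => by ring
    simp only [this]
    rw [uexpect_add, uexpect_add, uexpect_const_mul, hF, uexpect_const hne]
    ring
  rw [e2] at h
  simpa using h

lemma sub_one_div_pow_le (n : ℕ) : (((n : ℝ) + 1) / (n + 2)) ^ (n + 2) ≤ 1 / 2 := by
  have h := one_add_mul_le_pow (a := 1 / ((n : ℝ) + 1)) (by
    have : (0 : ℝ) ≤ 1 / (n + 1) := by positivity
    linarith) (n + 2)
  have h1 : (2 : ℝ) ≤ (1 + 1 / ((n : ℝ) + 1)) ^ (n + 2) := by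
    refine le_trans ?_ h
    have : (1 : ℝ) ≤ (n + 2 : ℕ) * (1 / ((n : ℝ) + 1)) := by
      rw [mul_one_div, le_div_iff₀ (by positivity)]
      push_cast
      linarith
    linarith
  have h2 : ((n : ℝ) + 1) / (n + 2) = (1 + 1 / ((n : ℝ) + 1))⁻¹ := by
    field_simp
    ring
  rw [h2, inv_pow, one_div (2 : ℝ)]
  exact inv_anti₀ (by norm_num) h1

lemma moment_recursion {a b V : ℝ} (hb : 0 ≤ b) (hV : 0 ≤ V) (n : ℕ)
    (h : b ^ (n + 2) ≤ a ^ (n + 2) + (n + 1) * (b ^ n * V)) (haV : a ^ 2 ≤ 4 * (n + 1) * V) :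
    b ^ 2 ≤ 4 * (n + 2) * V := by
  by_contra! hcon
  have hn : (0 : ℝ) ≤ n := Nat.cast_nonneg n
  have hb' : 0 < b := by
    rcases hb.eq_or_lt with h0 | h0
    · rw [← h0] at hcon
      have : 0 ≤ 4 * ((n : ℝ) + 2) * V := by positivity
      norm_num at hcon
      linarith
    · exact h0
  have hs : (a / b) ^ 2 ≤ (n + 1) / (n + 2) := by
    rw [div_pow, div_le_div_iff₀ (by positivity) (by positivity)]
    nlinarith
  have hs2 : ((a / b) ^ (n + 2)) ^ 2 ≤ 1 / 2 := by
    rw [← pow_mul, mul_comm, pow_mul]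
    exact (pow_le_pow_left₀ (by positivity) hs _).trans (sub_one_div_pow_le n)
  have hs3 : (a / b) ^ (n + 2) ≤ 3 / 4 := by
    by_contra! h'
    nlinarith
  have hV' : (n + 1) * (V / b ^ 2) < 1 / 4 := by
    rw [mul_div, div_lt_iff₀ (by positivity)]
    nlinarith
  have hfin : 1 ≤ (a / b) ^ (n + 2) + (n + 1) * (V / b ^ 2) := by
    have : b ^ (n + 2) * 1 ≤ b ^ (n + 2) * ((a / b) ^ (n + 2) + (n + 1) * (V / b ^ 2)) := by
      rw [mul_one]
      refine h.trans (le_of_eq ?_)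
      rw [div_pow]
      field_simp
      ring
    exact le_of_mul_le_mul_left this (by positivity)
  linarith

lemma perm_moment_le {F : Equiv.Perm α → ℝ} (hF : uexpect Finset.univ F = 0) {q : ℕ}
    (hq : 1 ≤ q) :
    (uexpect Finset.univ fun τ => F τ ^ (2 * q)) ≤
      (8 * q) ^ q * uexpect Finset.univ fun τ => swapGradSq F τ ^ q := by
  have hne : (Finset.univ : Finset (Equiv.Perm α)).Nonempty := ⟨1, Finset.mem_univ _⟩
  set f : Equiv.Perm α → ℝ := fun τ => |F τ| with hf
  have hf0 : ∀ τ ∈ (Finset.univ : Finset (Equiv.Perm α)), 0 ≤ f τ := fun τ _ => abs_nonneg _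
  set γ : Equiv.Perm α → ℝ := fun τ => √(swapGradSq F τ) with hγ
  have hγ0 : ∀ τ ∈ (Finset.univ : Finset (Equiv.Perm α)), 0 ≤ γ τ := fun τ _ => Real.sqrt_nonneg _
  have hγ2 : ∀ τ, γ τ ^ 2 = swapGradSq F τ := fun τ => Real.sq_sqrt (swapGradSq_nonneg F τ)
  set V := ulpNorm Finset.univ (2 * q) γ ^ 2 with hVdef
  have hVq : V ^ q = uexpect Finset.univ fun τ => swapGradSq F τ ^ q := by
    rw [hVdef, ← pow_mul, ulpNorm_pow (by omega) hγ0]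
    simp only [pow_mul, hγ2]
  have hV : 0 ≤ V := sq_nonneg _
  have hγn : ∀ m, m ≠ 0 → m ≤ 2 * q → ulpNorm Finset.univ m γ ^ 2 ≤ V := fun m h1 h2 =>
    pow_le_pow_left₀ (ulpNorm_nonneg hγ0) (ulpNorm_mono_exponent hne h1 h2 hγ0) 2
  have hvar : ulpNorm Finset.univ 2 f ^ 2 ≤ V := by
    rw [ulpNorm_pow two_ne_zero hf0]
    simp only [hf, sq_abs]
    refine (perm_variance_le hF).trans (le_trans (le_of_eq ?_) (hγn 2 two_ne_zero (by omega)))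
    rw [ulpNorm_pow two_ne_zero hγ0]
    simp only [hγ2]
  have key : ∀ m : ℕ, m + 1 ≤ 2 * q →
      ulpNorm Finset.univ (m + 1) f ^ 2 ≤ 4 * ((m : ℝ) + 1) * V := by
    intro m
    induction m with
    | zero =>
      intro _
      have h1 := ulpNorm_mono_exponent hne (m := 1) (n := 2) one_ne_zero (by omega) hf0
      have h2 := pow_le_pow_left₀ (ulpNorm_nonneg hf0) h1 2
      push_cast
      simp only [zero_add] at *
      nlinarith
    | succ m ih =>
      intro hm
      have h := moment_recursion (ulpNorm_nonneg (m := m + 2) hf0)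
        hV m ?_ (ih (by omega))
      · push_cast
        convert h using 2
        ring
      · have h1 := perm_entropy_grad m F f (fun τ => abs_nonneg _)
          (fun τ τ' => abs_abs_sub_abs_le_abs_sub _ _)
        rw [ulpNorm_pow (m := m + 2) (by omega) hf0]
        have h2 : (uexpect Finset.univ fun τ => f τ ^ m * swapGradSq F τ) ≤
            ulpNorm Finset.univ (m + 2) f ^ m * V := by
          simp only [← hγ2]
          refine (uexpect_pow_mul_pow_le hf0 hγ0 (by omega) (ulpNorm_nonneg (m := m + 2) hf0)
            (ulpNorm_nonneg (m := m + 2) hγ0) (ulpNorm_pow (by omega) hf0).ge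
            (ulpNorm_pow (by omega) hγ0).ge).trans ?_
          exact mul_le_mul_of_nonneg_left (hγn _ (by omega) hm)
            (pow_nonneg (ulpNorm_nonneg hf0) _)
        have h3 : (0 : ℝ) ≤ m + 1 := by positivity
        have := mul_le_mul_of_nonneg_left h2 h3
        linarith
  have hfin := key (2 * q - 1) (by omega)
  have e : 2 * q - 1 + 1 = 2 * q := by omega
  have e' : (((2 * q - 1 : ℕ) : ℝ) + 1) = 2 * q := by exact_mod_cast e
  rw [e, e'] at hfin
  calc (uexpect Finset.univ fun τ => F τ ^ (2 * q))
      = (ulpNorm Finset.univ (2 * q) f ^ 2) ^ q := by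
        rw [← pow_mul, ulpNorm_pow (by omega) hf0]
        exact uexpect_congr fun τ _ => by rw [pow_mul, pow_mul, hf]; simp only [sq_abs]
    _ ≤ (4 * (2 * q) * V) ^ q := pow_le_pow_left₀ (sq_nonneg _) hfin q
    _ = _ := by rw [mul_pow, hVq]; ring

end PermutationMoments

section MultilinearCalculus

variable {N : ℕ}

/-- The coefficients of the partial derivative of a multilinear polynomial. -/
def mlPartial (i : Fin N) (a : Finset (Fin N) → ℝ) (T : Finset (Fin N)) : ℝ :=
  if i ∈ T then 0 else a (insert i T)

/-- The coefficients of the directional derivative of a multilinear polynomial. -/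
def mlDir (v : Fin N → ℝ) (a : Finset (Fin N) → ℝ) (T : Finset (Fin N)) : ℝ :=
  ∑ i, v i * mlPartial i a T

lemma mlPoly_eq_sum (a : Finset (Fin N) → ℝ) (ω : Fin N → ℝ) :
    mlPoly a ω = ∑ S, a S * ∏ i ∈ S, ω i := by
  simp [mlPoly]

lemma mlPoly_eq_add (a : Finset (Fin N) → ℝ) (ω : Fin N → ℝ) (i : Fin N) :
    mlPoly a ω = ∑ T ∈ (Finset.univ.erase i).powerset, a T * ∏ j ∈ T, ω j +
      ω i * mlPoly (mlPartial i a) ω := by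
  have h : ∀ b : Finset (Fin N) → ℝ, mlPoly b ω =
      ∑ T ∈ (Finset.univ.erase i).powerset, b T * ∏ j ∈ T, ω j +
      ∑ T ∈ (Finset.univ.erase i).powerset, b (insert i T) * ∏ j ∈ insert i T, ω j := fun b => by
    rw [← Finset.sum_powerset_insert (Finset.notMem_erase i _)
      (fun T => b T * ∏ j ∈ T, ω j), Finset.insert_erase (Finset.mem_univ i)]
    rfl
  have hT : ∀ T ∈ (Finset.univ.erase i).powerset, i ∉ T := fun T hT hi => by
    have := Finset.mem_powerset.1 hT hi
    simp at this
  rw [h a, h (mlPartial i a)]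
  congr 1
  rw [mul_add, Finset.mul_sum, Finset.mul_sum, ← Finset.sum_add_distrib]
  refine Finset.sum_congr rfl fun T hT' => ?_
  have h1 := hT T hT'
  rw [Finset.prod_insert h1]
  simp only [mlPartial, h1, if_false, Finset.mem_insert_self, if_true]
  ring

lemma mlPoly_partial_update (a : Finset (Fin N) → ℝ) (ω : Fin N → ℝ) (i : Fin N) (s : ℝ) :
    mlPoly (mlPartial i a) (Function.update ω i s) = mlPoly (mlPartial i a) ω := by
  rw [mlPoly_eq_sum, mlPoly_eq_sum]
  refine Finset.sum_congr rfl fun S _ => ?_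
  by_cases hi : i ∈ S
  · simp [mlPartial, hi]
  · rw [Finset.prod_update_of_notMem hi]

lemma mlPoly_update (a : Finset (Fin N) → ℝ) (ω : Fin N → ℝ) (i : Fin N) (s : ℝ) :
    mlPoly a (Function.update ω i s) = mlPoly a ω + (s - ω i) * mlPoly (mlPartial i a) ω := by
  rw [mlPoly_eq_add a ω i, mlPoly_eq_add a (Function.update ω i s) i, mlPoly_partial_update,
    Function.update_self]
  have : ∑ T ∈ (Finset.univ.erase i).powerset, a T * ∏ j ∈ T, Function.update ω i s j =
      ∑ T ∈ (Finset.univ.erase i).powerset, a T * ∏ j ∈ T, ω j := by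
    refine Finset.sum_congr rfl fun T hT => ?_
    rw [Finset.prod_update_of_notMem]
    intro hi
    have := Finset.mem_powerset.1 hT hi
    simp at this
  rw [this]
  ring

lemma mlPoly_comp_swap (a : Finset (Fin N) → ℝ) (ω : Fin N → ℝ) (i j : Fin N) :
    mlPoly a (ω ∘ Equiv.swap i j) - mlPoly a ω = (ω j - ω i) *
      (mlPoly (mlPartial i a) ω - mlPoly (mlPartial j a) ω -
        (ω j - ω i) * mlPoly (mlPartial i (mlPartial j a)) ω) := by
  rcases eq_or_ne i j with rfl | hij
  · simp
  have h : ω ∘ Equiv.swap i j = Function.update (Function.update ω i (ω j)) j (ω i) := by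
    ext k
    rcases eq_or_ne k j with rfl | hk
    · simp
    · rcases eq_or_ne k i with rfl | hk'
      · simp [hk]
      · simp [hk, hk', Equiv.swap_apply_of_ne_of_ne]
  rw [h, mlPoly_update, mlPoly_update, mlPoly_update, Function.update_of_ne hij.symm]
  ring

lemma sq_mlPoly_comp_swap_le (a : Finset (Fin N) → ℝ) {ω : Fin N → ℝ} {X : ℝ} {i j : Fin N}
    (hX : |ω j - ω i| ≤ X) :
    (mlPoly a (ω ∘ Equiv.swap i j) - mlPoly a ω) ^ 2 ≤
      3 * X ^ 2 * (mlPoly (mlPartial i a) ω ^ 2 + mlPoly (mlPartial j a) ω ^ 2 +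
        X ^ 2 * mlPoly (mlPartial i (mlPartial j a)) ω ^ 2) := by
  rw [mlPoly_comp_swap]
  have hX2 : (ω j - ω i) ^ 2 ≤ X ^ 2 := by
    rw [← sq_abs]
    exact pow_le_pow_left₀ (abs_nonneg _) hX 2
  set u := mlPoly (mlPartial i a) ω
  set v := mlPoly (mlPartial j a) ω
  set w := mlPoly (mlPartial i (mlPartial j a)) ω
  set z := ω j - ω i
  have h1 : (u - v - z * w) ^ 2 ≤ 3 * (u ^ 2 + v ^ 2 + X ^ 2 * w ^ 2) := by
    have : z ^ 2 * w ^ 2 ≤ X ^ 2 * w ^ 2 := mul_le_mul_of_nonneg_right hX2 (sq_nonneg _)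
    nlinarith [sq_nonneg (u + v), sq_nonneg (u + z * w), sq_nonneg (v - z * w)]
  calc (z * (u - v - z * w)) ^ 2 = z ^ 2 * (u - v - z * w) ^ 2 := by ring
    _ ≤ X ^ 2 * (3 * (u ^ 2 + v ^ 2 + X ^ 2 * w ^ 2)) := by gcongr
    _ = _ := by ring

lemma mlPoly_dir (v : Fin N → ℝ) (a : Finset (Fin N) → ℝ) (ω : Fin N → ℝ) :
    mlPoly (mlDir v a) ω = ∑ i, v i * mlPoly (mlPartial i a) ω := by
  simp only [mlPoly_eq_sum, mlDir, Finset.sum_mul, Finset.mul_sum]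
  rw [Finset.sum_comm]
  simp only [mul_assoc]

lemma mlPartial_eq_zero {n : ℕ} {a : Finset (Fin N) → ℝ} (ha : ∀ S, n + 1 ≤ S.card → a S = 0)
    (i : Fin N) (S : Finset (Fin N)) (hS : n ≤ S.card) : mlPartial i a S = 0 := by
  unfold mlPartial
  split_ifs with h
  · rfl
  · exact ha _ (by rw [Finset.card_insert_of_notMem h]; omega)

lemma mlDir_eq_zero {n : ℕ} {a : Finset (Fin N) → ℝ} (ha : ∀ S, n + 1 ≤ S.card → a S = 0)
    (v : Fin N → ℝ) (S : Finset (Fin N)) (hS : n ≤ S.card) : mlDir v a S = 0 :=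
  Finset.sum_eq_zero fun i _ => by rw [mlPartial_eq_zero ha i S hS, mul_zero]

lemma mlDeriv_zero (a : Finset (Fin N) → ℝ) (ω : Fin N → ℝ) (idx : Fin 0 → Fin N) :
    mlDeriv a 0 ω idx = mlPoly a ω := by
  have : Function.Injective idx := Function.injective_of_subsingleton _
  simp [mlDeriv, this, mlPoly]

lemma mlDeriv_cons (a : Finset (Fin N) → ℝ) (k : ℕ) (ω : Fin N → ℝ) (i : Fin N)
    (idx : Fin k → Fin N) :
    mlDeriv a (k + 1) ω (Fin.cons i idx) = mlDeriv (mlPartial i a) k ω idx := by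
  have himg : Finset.image (Fin.cons i idx : Fin (k + 1) → Fin N) Finset.univ =
      insert i (Finset.image idx Finset.univ) := by
    ext y
    simp [Fin.exists_fin_succ, eq_comm]
  unfold mlDeriv
  rw [himg]
  by_cases hinj : Function.Injective idx
  · by_cases hi : i ∈ Set.range idx
    · rw [if_neg (by rw [Fin.cons_injective_iff]; tauto), if_pos hinj]
      symm
      refine Finset.sum_eq_zero fun S hS => ?_
      have : i ∈ S := (Finset.mem_filter.1 hS).2 (by simpa using hi)
      simp [mlPartial, this]
    · rw [if_pos (Fin.cons_injective_iff.2 ⟨hi, hinj⟩), if_pos hinj]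
      have hi' : i ∉ Finset.image idx Finset.univ := by simpa using hi
      rw [← Finset.sum_filter_add_sum_filter_not
        (Finset.filter (fun S => Finset.image idx Finset.univ ⊆ S) Finset.univ.powerset)
        (fun S => i ∈ S) (fun S => mlPartial i a S * _),
        Finset.sum_eq_zero (s := Finset.filter (fun S => i ∈ S) _), zero_add]
      · refine Finset.sum_nbij' (fun S => S.erase i) (fun T => insert i T) ?_ ?_ ?_ ?_ ?_
        · intro S hS
          simp only [Finset.mem_filter, Finset.powerset_univ, Finset.mem_univ, true_and,
            Finset.insert_subset_iff] at hS ⊢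
          exact ⟨fun y hy => Finset.mem_erase.2 ⟨fun h => hi' (h ▸ hy), hS.2 hy⟩,
            Finset.notMem_erase _ _⟩
        · intro T hT
          simp only [Finset.mem_filter, Finset.powerset_univ, Finset.mem_univ, true_and,
            Finset.insert_subset_iff] at hT ⊢
          exact ⟨Finset.mem_insert_self _ _, hT.1.trans (Finset.subset_insert _ _)⟩
        · intro S hS
          simp only [Finset.mem_filter, Finset.powerset_univ, Finset.mem_univ, true_and,
            Finset.insert_subset_iff] at hS
          exact Finset.insert_erase hS.1
        · intro T hT
          exact Finset.erase_insert (Finset.mem_filter.1 hT).2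
        · intro S hS
          simp only [Finset.mem_filter, Finset.powerset_univ, Finset.mem_univ, true_and,
            Finset.insert_subset_iff] at hS
          simp only [mlPartial, Finset.notMem_erase, if_false, Finset.insert_erase hS.1]
          rw [Finset.sdiff_insert, Finset.erase_sdiff_comm]
      · intro S hS
        simp [mlPartial, (Finset.mem_filter.1 hS).2]
  · rw [if_neg hinj, if_neg (by rw [Fin.cons_injective_iff]; tauto)]

lemma mlDeriv_dir (v : Fin N → ℝ) (a : Finset (Fin N) → ℝ) (k : ℕ) (ω : Fin N → ℝ)
    (idx : Fin k → Fin N) :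
    mlDeriv (mlDir v a) k ω idx = ∑ i, v i * mlDeriv (mlPartial i a) k ω idx := by
  unfold mlDeriv
  split_ifs
  · simp only [mlDir, Finset.sum_mul, Finset.mul_sum]
    rw [Finset.sum_comm]
    simp only [mul_assoc]
  · simp

/-- The value of the multilinear form given by a tensor on vectors. -/
def tensorApply {k : ℕ} (A : (Fin k → Fin N) → ℝ) (u : Fin k → Fin N → ℝ) : ℝ :=
  ∑ idx, A idx * ∏ j, u j (idx j)

lemma tensorApply_uexpect_mlDeriv_cons (M : Finset (Fin N → ℝ)) (a : Finset (Fin N) → ℝ) (k : ℕ)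
    (v : Fin N → ℝ) (u : Fin k → Fin N → ℝ) :
    tensorApply (fun idx => uexpect M fun ω => mlDeriv a (k + 1) ω idx) (Fin.cons v u) =
      tensorApply (fun idx => uexpect M fun ω => mlDeriv (mlDir v a) k ω idx) u := by
  unfold tensorApply
  rw [← (Fin.consEquiv fun _ : Fin (k + 1) => Fin N).sum_comp, Fintype.sum_prod_type,
    Finset.sum_comm]
  refine Finset.sum_congr rfl fun idx _ => ?_
  simp only [mlDeriv_dir, uexpect_sum, uexpect_const_mul, Finset.sum_mul]
  refine Finset.sum_congr rfl fun i _ => ?_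
  have h : ∀ ω, mlDeriv a (k + 1) ω ((Fin.consEquiv fun _ => Fin N) (i, idx)) =
      mlDeriv (mlPartial i a) k ω idx := fun ω => mlDeriv_cons a k ω i idx
  simp only [h]
  simp only [Fin.consEquiv_apply, Fin.prod_univ_succ, Fin.cons_zero, Fin.cons_succ]
  ring

lemma tensorApply_zero (A : (Fin 0 → Fin N) → ℝ) (u : Fin 0 → Fin N → ℝ) :
    tensorApply A u = A default := by
  simp [tensorApply]

end MultilinearCalculus

section MultisliceOrbit

variable {L N : ℕ} {κ : Fin L → ℕ} {x : Fin L → ℝ}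

lemma mem_multislice {ω : Fin N → ℝ} : ω ∈ multislice L N κ x ↔
    (∀ i, ∃ ℓ, x ℓ = ω i) ∧ ∀ ℓ, (Finset.univ.filter fun i => ω i = x ℓ).card = κ ℓ := by
  simp [multislice, Fintype.mem_piFinset]

lemma comp_perm_mem_multislice {y : Fin N → ℝ} (hy : y ∈ multislice L N κ x)
    (ρ : Equiv.Perm (Fin N)) : y ∘ ρ ∈ multislice L N κ x := by
  rw [mem_multislice] at hy ⊢
  refine ⟨fun i => hy.1 (ρ i), fun ℓ => ?_⟩
  rw [← hy.2 ℓ]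
  exact Finset.card_nbij' ρ ρ.symm (by intro i; simp) (by intro i; simp) (by intro i; simp)
    (by intro i; simp)

lemma exists_perm_of_mem_multislice {y ω : Fin N → ℝ} (hy : y ∈ multislice L N κ x)
    (hω : ω ∈ multislice L N κ x) : ∃ ρ : Equiv.Perm (Fin N), y ∘ ρ = ω := by
  rw [mem_multislice] at hy hω
  have hcard : ∀ v : ℝ, Fintype.card {i // ω i = v} = Fintype.card {i // y i = v} := by
    intro v
    rw [Fintype.card_subtype, Fintype.card_subtype]
    by_cases hv : ∃ ℓ, x ℓ = v
    · obtain ⟨ℓ, rfl⟩ := hv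
      rw [hy.2, hω.2]
    · rw [Finset.filter_eq_empty_iff.2, Finset.filter_eq_empty_iff.2]
      · exact fun i _ h => hv (h ▸ hy.1 i)
      · exact fun i _ h => hv (h ▸ hω.1 i)
  exact ⟨Equiv.ofFiberEquiv fun v => Fintype.equivOfCardEq (hcard v),
    funext fun i => Equiv.ofFiberEquiv_map _ i⟩

lemma uexpect_perm_eq_uexpect_multislice {y : Fin N → ℝ} (hy : y ∈ multislice L N κ x)
    (G : (Fin N → ℝ) → ℝ) :
    (uexpect Finset.univ fun τ : Equiv.Perm (Fin N) => G (y ∘ ⇑τ⁻¹)) =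
      uexpect (multislice L N κ x) G := by
  set M := multislice L N κ x
  set c := (Finset.univ.filter fun τ : Equiv.Perm (Fin N) => y ∘ ⇑τ⁻¹ = y).card with hc
  have hmaps : ∀ τ ∈ (Finset.univ : Finset (Equiv.Perm (Fin N))), y ∘ ⇑τ⁻¹ ∈ M := fun τ _ =>
    comp_perm_mem_multislice hy _
  have hcard : ∀ ω ∈ M,
      (Finset.univ.filter fun τ : Equiv.Perm (Fin N) => y ∘ ⇑τ⁻¹ = ω).card = c := by
    intro ω hω
    obtain ⟨ρ, rfl⟩ := exists_perm_of_mem_multislice hy hω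
    refine Finset.card_nbij' (fun τ => ρ * τ) (fun τ => ρ⁻¹ * τ) ?_ ?_ ?_ ?_
    · intro τ hτ
      simp only [Finset.coe_filter, Finset.mem_univ, true_and, Set.mem_ofPred_eq] at hτ ⊢
      rw [mul_inv_rev, Equiv.Perm.coe_mul, ← Function.comp_assoc, hτ, Function.comp_assoc,
        ← Equiv.Perm.coe_mul, mul_inv_cancel, Equiv.Perm.coe_one, Function.comp_id]
    · intro τ hτ
      simp only [Finset.coe_filter, Finset.mem_univ, true_and, Set.mem_ofPred_eq] at hτ ⊢
      rw [mul_inv_rev, inv_inv, Equiv.Perm.coe_mul, ← Function.comp_assoc, hτ]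
    · intro τ _
      simp
    · intro τ _
      simp
  have hc0 : (c : ℝ) ≠ 0 := by
    have : 0 < c := Finset.card_pos.2 ⟨1, by
      rw [Finset.mem_filter, inv_one, Equiv.Perm.coe_one, Function.comp_id]
      exact ⟨Finset.mem_univ _, rfl⟩⟩
    exact_mod_cast this.ne'
  unfold uexpect
  rw [← Finset.sum_fiberwise_of_maps_to hmaps, Finset.card_eq_sum_card_fiberwise hmaps,
    Finset.sum_congr rfl hcard]
  have : ∀ ω ∈ M, (∑ τ ∈ Finset.univ.filter (fun τ : Equiv.Perm (Fin N) => y ∘ ⇑τ⁻¹ = ω),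
      G (y ∘ ⇑τ⁻¹)) = G ω * c := by
    intro ω hω
    rw [Finset.sum_congr rfl (g := fun _ => G ω)
      (fun τ hτ => by rw [(Finset.mem_filter.1 hτ).2]), Finset.sum_const, hcard ω hω, nsmul_eq_mul,
      mul_comm]
  rw [Finset.sum_congr rfl this, ← Finset.sum_mul, Finset.sum_const, smul_eq_mul]
  push_cast
  rw [mul_div_mul_right _ _ hc0]

lemma multislice_moment_le (hM : (multislice L N κ x).Nonempty) {X : ℝ}
    (hX : ∀ i j, |x i - x j| ≤ X) (a : Finset (Fin N) → ℝ) {q : ℕ} (hq : 1 ≤ q) :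
    (uexpect (multislice L N κ x) fun ω =>
        (mlPoly a ω - uexpect (multislice L N κ x) (mlPoly a)) ^ (2 * q)) ≤
      (8 * q) ^ q * uexpect (multislice L N κ x) fun ω =>
        (6 * X ^ 2 * ∑ i, mlPoly (mlPartial i a) ω ^ 2 + 3 * X ^ 4 *
          ((∑ i, ∑ j, mlPoly (mlPartial j (mlPartial i a)) ω ^ 2) / N)) ^ q := by
  obtain ⟨y, hy⟩ := hM
  set M := multislice L N κ x
  set e := uexpect M (mlPoly a)
  have hne : (Finset.univ : Finset (Equiv.Perm (Fin N))).Nonempty := ⟨1, Finset.mem_univ _⟩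
  set F : Equiv.Perm (Fin N) → ℝ := fun τ => mlPoly a (y ∘ ⇑τ⁻¹) - e with hF
  have hF0 : uexpect Finset.univ F = 0 := by
    rw [hF, uexpect_sub, uexpect_perm_eq_uexpect_multislice hy, uexpect_const hne, sub_self]
  rw [← uexpect_perm_eq_uexpect_multislice hy, ← uexpect_perm_eq_uexpect_multislice hy]
  refine (perm_moment_le hF0 hq).trans ?_
  refine mul_le_mul_of_nonneg_left (uexpect_mono fun τ _ => ?_) (by positivity)
  refine pow_le_pow_left₀ (swapGradSq_nonneg _ _) ?_ q
  have hyX : ∀ i j, |y i - y j| ≤ X := fun i j => by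
    obtain ⟨k, hk⟩ := (mem_multislice.1 hy).1 i
    obtain ⟨l, hl⟩ := (mem_multislice.1 hy).1 j
    rw [← hk, ← hl]
    exact hX k l
  set ω := y ∘ ⇑τ⁻¹ with hω
  have hterm : ∀ i j, (F τ - F (Equiv.swap i j * τ)) ^ 2 ≤
      3 * X ^ 2 * (mlPoly (mlPartial i a) ω ^ 2 + mlPoly (mlPartial j a) ω ^ 2 +
        X ^ 2 * mlPoly (mlPartial j (mlPartial i a)) ω ^ 2) := by
    intro i j
    have h := sq_mlPoly_comp_swap_le a (ω := ω) (X := X) (i := j) (j := i) (hyX _ _)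
    have e1 : F τ - F (Equiv.swap i j * τ) =
        -(mlPoly a (ω ∘ Equiv.swap j i) - mlPoly a ω) := by
      simp only [hF]
      rw [mul_inv_rev, Equiv.swap_inv, Equiv.Perm.coe_mul, ← Function.comp_assoc, ← hω,
        Equiv.swap_comm]
      ring
    rw [e1, neg_sq]
    refine h.trans (le_of_eq ?_)
    ring
  rcases Nat.eq_zero_or_pos N with hN | hN
  · subst hN
    simp [swapGradSq]
  have hN' : (0 : ℝ) < N := by exact_mod_cast hN
  unfold swapGradSq
  rw [Fintype.card_fin, div_le_iff₀ hN']
  refine (Finset.sum_le_sum fun i _ => Finset.sum_le_sum fun j _ => hterm i j).trans (le_of_eq ?_)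
  simp only [← Finset.mul_sum, Finset.sum_add_distrib, Finset.sum_const, Finset.card_univ,
    Fintype.card_fin, nsmul_eq_mul]
  field_simp
  ring

end MultisliceOrbit

section Rademacher

variable {K : Type*} [Fintype K] [DecidableEq K]

/-- The sign encoded by a Boolean. -/
def boolSign (b : Bool) : ℝ := if b then 1 else -1

lemma uexpect_bool_prod (f : K → Bool → ℝ) :
    (uexpect Finset.univ fun ε : K → Bool => ∏ k, f k (ε k)) =
      ∏ k, ((f k true + f k false) / 2) := by
  unfold uexpect
  rw [Finset.prod_div_distrib]
  congr 1
  · have h := (Finset.prod_univ_sum (fun _ : K => (Finset.univ : Finset Bool)) f).symm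
    rw [Fintype.piFinset_univ] at h
    rw [h]
    simp
  · simp

/-- The density obtained by tilting independent signs to have means `z k`. -/
def signTilt (z : K → ℝ) (ε : K → Bool) : ℝ := ∏ k, (1 + z k * boolSign (ε k))

lemma signTilt_nonneg {z : K → ℝ} (hz : ∀ k, |z k| ≤ 1) (ε : K → Bool) : 0 ≤ signTilt z ε := by
  refine Finset.prod_nonneg fun k _ => ?_
  have h := abs_le.1 (hz k)
  unfold boolSign
  split_ifs <;> linarith

lemma uexpect_signTilt (z : K → ℝ) : uexpect Finset.univ (signTilt z) = 1 := by
  refine (uexpect_bool_prod fun k b => 1 + z k * boolSign b).trans ?_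
  refine Finset.prod_eq_one fun k _ => ?_
  simp only [boolSign, if_true, Bool.false_eq_true, if_false]
  ring

lemma prod_ite_sign (ε : K → Bool) (k : K) :
    boolSign (ε k) = ∏ j, if j = k then boolSign (ε j) else 1 := by
  simp

lemma uexpect_signTilt_mul (z : K → ℝ) (k : K) :
    (uexpect Finset.univ fun ε => signTilt z ε * boolSign (ε k)) = z k := by
  have h : ∀ ε : K → Bool, signTilt z ε * boolSign (ε k) =
      ∏ j, (1 + z j * boolSign (ε j)) * if j = k then boolSign (ε j) else 1 := fun ε => by
    rw [Finset.prod_mul_distrib, ← prod_ite_sign]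
    rfl
  simp only [h]
  rw [uexpect_bool_prod fun j b => (1 + z j * boolSign b) * if j = k then boolSign b else 1]
  rw [Finset.prod_congr rfl (g := fun j => if j = k then z j else 1)]
  · simp
  · intro j _
    simp only [boolSign, if_true, Bool.false_eq_true, if_false]
    split_ifs <;> ring

lemma uexpect_signTilt_mul_mul (z : K → ℝ) (k k' : K) :
    (uexpect Finset.univ fun ε => signTilt z ε * (boolSign (ε k) * boolSign (ε k'))) =
      z k * z k' + if k = k' then 1 - z k ^ 2 else 0 := by
  rcases eq_or_ne k k' with rfl | hk
  · have : ∀ b, boolSign b * boolSign b = 1 := fun b => by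
      unfold boolSign
      split_ifs <;> norm_num
    simp only [this, mul_one, if_true]
    rw [uexpect_signTilt]
    ring
  have h : ∀ ε : K → Bool, signTilt z ε * (boolSign (ε k) * boolSign (ε k')) =
      ∏ j, (1 + z j * boolSign (ε j)) * ((if j = k then boolSign (ε j) else 1) *
        if j = k' then boolSign (ε j) else 1) := fun ε => by
    rw [Finset.prod_mul_distrib, Finset.prod_mul_distrib, ← prod_ite_sign, ← prod_ite_sign]
    rfl
  simp only [h]
  rw [uexpect_bool_prod fun j b => (1 + z j * boolSign b) * ((if j = k then boolSign b else 1) *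
        if j = k' then boolSign b else 1)]
  rw [Finset.prod_congr rfl
    (g := fun j => (if j = k then z j else 1) * if j = k' then z j else 1)]
  · rw [Finset.prod_mul_distrib]
    simp [hk]
  · intro j _
    simp only [boolSign, if_true, Bool.false_eq_true, if_false]
    split_ifs with h1 h2
    · exact absurd (h1.symm.trans h2) hk
    all_goals ring

lemma uexpect_signTilt_sq_le (z : K → ℝ) :
    (uexpect Finset.univ fun ε => signTilt z ε ^ 2) ≤ Real.exp (∑ k, z k ^ 2) := by
  have h : ∀ ε : K → Bool, signTilt z ε ^ 2 = ∏ k, (1 + z k * boolSign (ε k)) ^ 2 := fun ε => by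
    rw [Finset.prod_pow]
    rfl
  simp only [h]
  rw [uexpect_bool_prod fun k b => (1 + z k * boolSign b) ^ 2, Real.exp_sum]
  refine Finset.prod_le_prod (fun k _ => by positivity) fun k _ => ?_
  have := Real.add_one_le_exp (z k ^ 2)
  simp only [boolSign]
  norm_num
  nlinarith

lemma uexpect_exp_sign_sum_le (c : K → ℝ) :
    (uexpect Finset.univ fun ε : K → Bool => Real.exp (∑ k, c k * boolSign (ε k))) ≤
      Real.exp ((∑ k, c k ^ 2) / 2) := by
  simp only [Real.exp_sum]
  rw [uexpect_bool_prod fun k b => Real.exp (c k * boolSign b), Finset.sum_div, Real.exp_sum]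
  refine Finset.prod_le_prod (fun k _ => by positivity) fun k _ => ?_
  refine le_trans (le_of_eq ?_) (Real.cosh_le_exp_half_sq (c k))
  simp [boolSign, Real.cosh_eq]

lemma even_pow_le_factorial_mul_exp (x : ℝ) (s : ℕ) :
    x ^ (2 * s) ≤ (2 * s).factorial * (Real.exp x + Real.exp (-x)) := by
  have h1 : |x| ^ (2 * s) / (2 * s).factorial ≤ Real.exp |x| :=
    Real.pow_div_factorial_le_exp _ (abs_nonneg x) _
  rw [div_le_iff₀ (by positivity), pow_mul, sq_abs, ← pow_mul] at h1
  refine h1.trans ?_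
  rw [mul_comm]
  gcongr
  rcases abs_cases x with h | h <;> rw [h.1]
  · linarith [Real.exp_pos (-x)]
  · linarith [Real.exp_pos x]

/-- Khintchine's inequality for even moments. -/
lemma khintchine (c : K → ℝ) (s : ℕ) :
    (uexpect Finset.univ fun ε : K → Bool => (∑ k, c k * boolSign (ε k)) ^ (2 * s)) ≤
      (12 * s * ∑ k, c k ^ 2) ^ s := by
  have hne : (Finset.univ : Finset (K → Bool)).Nonempty := Finset.univ_nonempty
  rcases Nat.eq_zero_or_pos s with rfl | hs
  · simp [uexpect_const hne]
  have hs' : (0 : ℝ) < s := by exact_mod_cast hs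
  set V := ∑ k, c k ^ 2 with hV
  rcases (Finset.sum_nonneg fun k _ => sq_nonneg (c k) : 0 ≤ V).eq_or_lt with h0 | hpos
  · have hc : ∀ k, c k = 0 := fun k => by
      have := (Finset.sum_eq_zero_iff_of_nonneg fun k _ => sq_nonneg (c k)).1 h0.symm k
        (Finset.mem_univ k)
      exact pow_eq_zero_iff two_ne_zero |>.1 this
    have hV0 : V = 0 := h0.symm
    rw [hV0]
    simp [hc, uexpect_const hne, hs.ne']
  set r := √(2 * s / V) with hr
  have hr2 : r ^ 2 = 2 * s / V := Real.sq_sqrt (by positivity)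
  have hexp : ∀ r' : ℝ, r' ^ 2 = 2 * s / V →
      (uexpect Finset.univ fun ε : K → Bool => Real.exp (r' * ∑ k, c k * boolSign (ε k))) ≤
        Real.exp s := by
    intro r' hr'
    have h := uexpect_exp_sign_sum_le fun k => r' * c k
    simp only [mul_pow, ← Finset.mul_sum, mul_assoc] at h
    rw [← hV, hr', div_mul_cancel₀ _ hpos.ne', mul_div_cancel_left₀ _ (two_ne_zero' ℝ)] at h
    exact h
  have h1 : r ^ (2 * s) *
      (uexpect Finset.univ fun ε : K → Bool => (∑ k, c k * boolSign (ε k)) ^ (2 * s)) ≤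
      (2 * s).factorial * (Real.exp s + Real.exp s) := by
    rw [← uexpect_const_mul]
    refine (uexpect_mono (g := fun ε => ((2 * s).factorial : ℝ) *
      (Real.exp (r * ∑ k, c k * boolSign (ε k)) +
        Real.exp (-r * ∑ k, c k * boolSign (ε k)))) fun ε _ => ?_).trans ?_
    · rw [← mul_pow, neg_mul]
      exact even_pow_le_factorial_mul_exp _ _
    · rw [uexpect_const_mul, uexpect_add]
      gcongr
      · exact hexp _ hr2
      · exact hexp _ (by rw [neg_sq, hr2])
  have h2 : ((2 * s).factorial : ℝ) ≤ (2 * s) ^ (2 * s) := by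
    exact_mod_cast Nat.factorial_le_pow (2 * s)
  have h3 : Real.exp s + Real.exp s ≤ 6 ^ s := by
    have : Real.exp s ≤ 3 ^ s := by
      rw [← mul_one (s : ℝ), Real.exp_nat_mul]
      exact pow_le_pow_left₀ (Real.exp_pos _).le (by linarith [Real.exp_one_lt_d9]) s
    have h2s : (2 : ℝ) ≤ 2 ^ s := by
      calc (2 : ℝ) = 2 ^ 1 := by norm_num
        _ ≤ 2 ^ s := pow_le_pow_right₀ (by norm_num) hs
    calc Real.exp s + Real.exp s = 2 * Real.exp s := by ring
      _ ≤ 2 ^ s * 3 ^ s := by gcongr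
      _ = 6 ^ s := by rw [← mul_pow]; norm_num
  have hrpos : 0 < r ^ (2 * s) := by
    rw [pow_mul, hr2]
    positivity
  refine le_of_mul_le_mul_left (h1.trans ?_) hrpos
  calc ((2 * s).factorial : ℝ) * (Real.exp s + Real.exp s) ≤ (2 * s) ^ (2 * s) * 6 ^ s := by
        gcongr
    _ = r ^ (2 * s) * (12 * s * V) ^ s := by
        rw [pow_mul, pow_mul, hr2, ← mul_pow, ← mul_pow]
        congr 1
        have hV0 : V ≠ 0 := hpos.ne'
        field_simp
        ring

end Rademacher

section SignMean

variable {ι : Type*} [Fintype ι] [DecidableEq ι] {p : ℕ}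

/-- The normalised sum of `p` signs in each coordinate. -/
def signMean (ε : ι × Fin p → Bool) (i : ι) : ℝ := (∑ l, boolSign (ε (i, l))) / p

/-- The density on sign arrays tilting the coordinate `i` to have mean `x i`. -/
def meanTilt (x : ι → ℝ) (ε : ι × Fin p → Bool) : ℝ := signTilt (fun k => x k.1) ε

lemma sum_mul_signMean (v : ι → ℝ) (ε : ι × Fin p → Bool) :
    ∑ i, v i * signMean ε i = ∑ k, v k.1 / p * boolSign (ε k) := by
  rw [Fintype.sum_prod_type]
  refine Finset.sum_congr rfl fun i _ => ?_
  rw [signMean, mul_div_assoc', mul_sum, sum_div]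
  exact Finset.sum_congr rfl fun l _ => by ring

lemma khintchine_signMean (hp : 1 ≤ p) (v : ι → ℝ) (s : ℕ) :
    (uexpect Finset.univ fun ε : ι × Fin p → Bool => (∑ i, v i * signMean ε i) ^ (2 * s)) ≤
      (12 * s / p * ∑ i, v i ^ 2) ^ s := by
  have hp' : (p : ℝ) ≠ 0 := by positivity
  simp only [sum_mul_signMean]
  refine (khintchine _ s).trans (le_of_eq ?_)
  congr 1
  rw [Fintype.sum_prod_type]
  simp only [div_pow, Finset.sum_const, Finset.card_univ, Fintype.card_fin, nsmul_eq_mul,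
    ← Finset.mul_sum, ← Finset.sum_div]
  field_simp

lemma meanTilt_nonneg {x : ι → ℝ} (hx : ∑ i, x i ^ 2 ≤ 1) (ε : ι × Fin p → Bool) :
    0 ≤ meanTilt x ε := by
  refine signTilt_nonneg (fun k => ?_) ε
  have := (Finset.single_le_sum (f := fun i => x i ^ 2) (fun i _ => sq_nonneg _)
    (Finset.mem_univ k.1)).trans hx
  exact (sq_le_one_iff_abs_le_one _).1 this

lemma uexpect_meanTilt (x : ι → ℝ) :
    uexpect Finset.univ (meanTilt x : (ι × Fin p → Bool) → ℝ) = 1 :=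
  uexpect_signTilt _

lemma uexpect_meanTilt_sq_le {x : ι → ℝ} (hx : ∑ i, x i ^ 2 ≤ 1) :
    (uexpect Finset.univ fun ε : ι × Fin p → Bool => meanTilt x ε ^ 2) ≤ Real.exp p := by
  refine (uexpect_signTilt_sq_le _).trans (Real.exp_le_exp.2 ?_)
  rw [Fintype.sum_prod_type]
  simp only [Finset.sum_const, Finset.card_univ, Fintype.card_fin, nsmul_eq_mul, ← Finset.mul_sum]
  exact mul_le_of_le_one_right (by positivity) hx

lemma uexpect_meanTilt_mul (hp : 1 ≤ p) (x : ι → ℝ) (i : ι) :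
    (uexpect Finset.univ fun ε : ι × Fin p → Bool => meanTilt x ε * signMean ε i) = x i := by
  have hp' : (p : ℝ) ≠ 0 := by positivity
  have h : ∀ ε : ι × Fin p → Bool, meanTilt x ε * signMean ε i =
      (p : ℝ)⁻¹ * ∑ l, meanTilt x ε * boolSign (ε (i, l)) := fun ε => by
    rw [signMean, ← Finset.mul_sum]
    ring
  simp only [h]
  rw [uexpect_const_mul, uexpect_sum]
  have h2 : ∀ l : Fin p, (uexpect Finset.univ fun ε : ι × Fin p → Bool =>
      meanTilt x ε * boolSign (ε (i, l))) = x i := fun l =>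
    uexpect_signTilt_mul (fun k : ι × Fin p => x k.1) (i, l)
  simp only [h2]
  simp [hp']

lemma uexpect_meanTilt_mul_mul (hp : 1 ≤ p) (x : ι → ℝ) (i j : ι) :
    (uexpect Finset.univ fun ε : ι × Fin p → Bool =>
      meanTilt x ε * (signMean ε i * signMean ε j)) =
      x i * x j + if i = j then (1 - x i ^ 2) / p else 0 := by
  have hp' : (p : ℝ) ≠ 0 := by positivity
  have h : ∀ ε : ι × Fin p → Bool, meanTilt x ε * (signMean ε i * signMean ε j) =
      ((p : ℝ)⁻¹) ^ 2 * ∑ l, ∑ m, meanTilt x ε * (boolSign (ε (i, l)) * boolSign (ε (j, m))) :=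
    fun ε => by
      simp only [← Finset.mul_sum, ← Finset.sum_mul]
      rw [signMean, signMean]
      ring
  simp only [h]
  rw [uexpect_const_mul, uexpect_sum]
  have h2 : ∀ l m : Fin p, (uexpect Finset.univ fun ε : ι × Fin p → Bool =>
      meanTilt x ε * (boolSign (ε (i, l)) * boolSign (ε (j, m)))) =
      x i * x j + if l = m then (if i = j then 1 - x i ^ 2 else 0) else 0 := fun l m => by
    refine (uexpect_signTilt_mul_mul (fun k : ι × Fin p => x k.1) (i, l) (j, m)).trans ?_
    simp only [Prod.mk.injEq]
    by_cases h1 : i = j <;> by_cases h2 : l = m <;> simp [h1, h2]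
  simp only [uexpect_sum, h2]
  simp only [Finset.sum_add_distrib, Finset.sum_ite_eq, Finset.mem_univ, if_true, Finset.sum_const,
    Finset.card_univ, Fintype.card_fin, nsmul_eq_mul]
  split_ifs
  · field_simp
  · field_simp
    ring

lemma uexpect_density_pow_le {α : Type*} {Ω : Finset α} {w Y : α → ℝ} (hw : ∀ ω ∈ Ω, 0 ≤ w ω)
    (hw1 : uexpect Ω w = 1) (hY : ∀ ω ∈ Ω, 0 ≤ Y ω) (q : ℕ) :
    (uexpect Ω fun ω => w ω * Y ω) ^ (2 * q) ≤
      (uexpect Ω fun ω => w ω ^ 2) * uexpect Ω fun ω => Y ω ^ (2 * q) := by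
  have h0 : 0 ≤ uexpect Ω fun ω => w ω * Y ω :=
    uexpect_nonneg fun ω hω => mul_nonneg (hw ω hω) (hY ω hω)
  have h1 := uexpect_density_mul_pow_le hw hw1 hY q
  have h2 := uexpect_mul_sq_le (Ω := Ω) w fun ω => Y ω ^ q
  rw [mul_comm 2 q, pow_mul]
  refine (pow_le_pow_left₀ (pow_nonneg h0 q) h1 2).trans (h2.trans (le_of_eq ?_))
  simp only [← pow_mul]

/-- A reverse Khintchine inequality with an exponential constant. -/
lemma norm_pow_le_uexpect_signMean (hp : 1 ≤ p) (v : ι → ℝ) {q : ℕ} (hq : 1 ≤ q) :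
    (∑ i, v i ^ 2) ^ q ≤ Real.exp p *
      uexpect Finset.univ fun ε : ι × Fin p → Bool => (∑ i, v i * signMean ε i) ^ (2 * q) := by
  set V := ∑ i, v i ^ 2 with hV
  have hV0 : 0 ≤ V := Finset.sum_nonneg fun i _ => sq_nonneg _
  have hE0 : 0 ≤ uexpect Finset.univ fun ε : ι × Fin p → Bool =>
      (∑ i, v i * signMean ε i) ^ (2 * q) :=
    uexpect_nonneg fun ε _ => by rw [pow_mul]; positivity
  rcases hV0.eq_or_lt with h0 | hpos
  · rw [← h0, zero_pow (by omega)]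
    positivity
  have hs : √V ^ 2 = V := Real.sq_sqrt hV0
  have hs0 : 0 < √V := Real.sqrt_pos.2 hpos
  set x : ι → ℝ := fun i => v i / √V with hx
  have hx1 : ∑ i, x i ^ 2 ≤ 1 := by
    simp only [hx, div_pow, hs, ← Finset.sum_div]
    exact div_self_le_one _
  have h1 : (uexpect Finset.univ fun ε : ι × Fin p → Bool =>
      meanTilt x ε * ∑ i, v i * signMean ε i) = √V := by
    simp only [Finset.mul_sum]
    rw [uexpect_sum]
    have : ∀ i, (uexpect Finset.univ fun ε : ι × Fin p → Bool =>
        meanTilt x ε * (v i * signMean ε i)) = v i * x i := fun i => by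
      rw [← uexpect_meanTilt_mul hp x i, ← uexpect_const_mul]
      exact uexpect_congr fun ε _ => by ring
    rw [Finset.sum_congr rfl fun i _ => this i]
    simp only [hx, mul_div_assoc', ← Finset.sum_div, ← sq]
    rw [← hV, div_eq_iff hs0.ne', ← sq, hs]
  have h2 : √V ≤ uexpect Finset.univ fun ε : ι × Fin p → Bool =>
      meanTilt x ε * |∑ i, v i * signMean ε i| := by
    rw [← h1]
    exact uexpect_mono fun ε _ => mul_le_mul_of_nonneg_left (le_abs_self _) (meanTilt_nonneg hx1 ε)
  calc V ^ q = √V ^ (2 * q) := by rw [pow_mul, hs]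
    _ ≤ _ := pow_le_pow_left₀ hs0.le h2 _
    _ ≤ _ := uexpect_density_pow_le (fun ε _ => meanTilt_nonneg hx1 ε) (uexpect_meanTilt x)
        (fun ε _ => abs_nonneg _) q
    _ ≤ _ := by
        simp only [pow_mul, sq_abs]
        refine mul_le_mul_of_nonneg_right (uexpect_meanTilt_sq_le hx1) ?_
        simpa only [pow_mul] using hE0

end SignMean

section ChaosExpansion

variable {L N : ℕ} {κ : Fin L → ℕ} {x : Fin L → ℝ}

lemma uexpect_fin_cons {β : Type*} [Fintype β] (k : ℕ) (G : (Fin (k + 1) → β) → ℝ) :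
    uexpect Finset.univ G =
      uexpect Finset.univ fun b => uexpect Finset.univ fun g : Fin k → β => G (Fin.cons b g) := by
  simp only [uexpect, ← Finset.sum_div, Finset.card_univ]
  rw [← (Fin.consEquiv fun _ : Fin (k + 1) => β).sum_comp, Fintype.sum_prod_type, div_div]
  congr 1
  rw [Fintype.card_fun, Fintype.card_fun, Fintype.card_fin, Fintype.card_fin, pow_succ]
  push_cast
  rfl

/-- The `2q`-th moment of the chaos of order `k` attached to the mean `k`-th derivative. -/
def chaosMoment (M : Finset (Fin N → ℝ)) (q k : ℕ) (a : Finset (Fin N) → ℝ) : ℝ :=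
  uexpect Finset.univ fun g : Fin k → Fin N × Fin (2 * q) → Bool =>
    tensorApply (fun idx => uexpect M fun ω => mlDeriv a k ω idx) (fun j => signMean (g j)) ^
      (2 * q)

lemma chaosMoment_nonneg (M : Finset (Fin N → ℝ)) (q k : ℕ) (a : Finset (Fin N) → ℝ) :
    0 ≤ chaosMoment M q k a :=
  uexpect_nonneg fun g _ => by rw [pow_mul]; positivity

lemma chaosMoment_zero (M : Finset (Fin N → ℝ)) (q : ℕ) (a : Finset (Fin N) → ℝ) :
    chaosMoment M q 0 a = uexpect M (mlPoly a) ^ (2 * q) := by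
  unfold chaosMoment
  simp only [tensorApply_zero, mlDeriv_zero]
  rw [uexpect_const Finset.univ_nonempty]

lemma chaosMoment_succ (M : Finset (Fin N → ℝ)) (q k : ℕ) (a : Finset (Fin N) → ℝ) :
    chaosMoment M q (k + 1) a = uexpect Finset.univ fun ε : Fin N × Fin (2 * q) → Bool =>
      chaosMoment M q k (mlDir (signMean ε) a) := by
  unfold chaosMoment
  rw [uexpect_fin_cons]
  refine uexpect_congr fun ε _ => uexpect_congr fun g _ => ?_
  rw [← tensorApply_uexpect_mlDeriv_cons]
  congr 2
  ext j
  refine Fin.cases ?_ (fun i => ?_) j <;> simp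

lemma mlPartial_comm (i j : Fin N) (a : Finset (Fin N) → ℝ) :
    mlPartial i (mlPartial j a) = mlPartial j (mlPartial i a) := by
  ext T
  unfold mlPartial
  by_cases hi : i ∈ T <;> by_cases hj : j ∈ T <;>
    simp [hi, hj, Finset.insert_comm, eq_comm]

lemma mlPartial_dir (i : Fin N) (v : Fin N → ℝ) (a : Finset (Fin N) → ℝ) :
    mlPartial i (mlDir v a) = mlDir v (mlPartial i a) := by
  ext T
  unfold mlDir
  simp only [fun j => mlPartial_comm j i a]
  by_cases hi : i ∈ T
  · simp [mlPartial, hi]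
  · simp [mlPartial, hi]

lemma gradient_pow_le {q : ℕ} (hq : 1 ≤ q) (a : Finset (Fin N) → ℝ) (ω : Fin N → ℝ) :
    (∑ i, mlPoly (mlPartial i a) ω ^ 2) ^ q ≤ 9 ^ q *
      uexpect Finset.univ fun ε : Fin N × Fin (2 * q) → Bool =>
        mlPoly (mlDir (signMean ε) a) ω ^ (2 * q) := by
  refine (norm_pow_le_uexpect_signMean (p := 2 * q) (by omega)
    (fun i => mlPoly (mlPartial i a) ω) hq).trans ?_
  simp only [mlPoly_dir, mul_comm (signMean _ _)]
  refine mul_le_mul_of_nonneg_right ?_ (uexpect_nonneg fun ε _ => by rw [pow_mul]; positivity)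
  push_cast
  rw [mul_comm, Real.exp_nat_mul]
  refine pow_le_pow_left₀ (Real.exp_pos _).le ?_ q
  have h : Real.exp 2 = Real.exp 1 ^ 2 := by rw [← Real.exp_nat_mul]; norm_num
  rw [h]
  have := Real.exp_one_lt_d9
  have h0 := Real.exp_pos 1
  nlinarith

lemma hessian_pow_le {q : ℕ} (hq : 1 ≤ q) (a : Finset (Fin N) → ℝ) (ω : Fin N → ℝ) :
    ((∑ i, ∑ j, mlPoly (mlPartial j (mlPartial i a)) ω ^ 2) / N) ^ q ≤ 81 ^ q *
      uexpect Finset.univ fun ε : Fin N × Fin (2 * q) → Bool =>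
        uexpect Finset.univ fun ε' : Fin N × Fin (2 * q) → Bool =>
          mlPoly (mlDir (signMean ε') (mlDir (signMean ε) a)) ω ^ (2 * q) := by
  rcases Nat.eq_zero_or_pos N with hN | hN
  · subst hN
    simp only [Nat.cast_zero, div_zero, zero_pow (show q ≠ 0 by omega)]
    refine mul_nonneg (by positivity) (uexpect_nonneg fun _ _ => uexpect_nonneg fun _ _ => ?_)
    rw [pow_mul]
    positivity
  have hne : (Finset.univ : Finset (Fin N)).Nonempty := ⟨⟨0, hN⟩, Finset.mem_univ _⟩
  have e : (∑ i, ∑ j, mlPoly (mlPartial j (mlPartial i a)) ω ^ 2) / N =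
      uexpect Finset.univ fun i => ∑ j, mlPoly (mlPartial j (mlPartial i a)) ω ^ 2 := by
    simp [uexpect]
  rw [e]
  refine (uexpect_pow_le hne (fun i _ => Finset.sum_nonneg fun j _ => sq_nonneg _) q).trans ?_
  have h81 : (81 : ℝ) ^ q = 9 ^ q * 9 ^ q := by rw [← mul_pow]; norm_num
  rw [h81, mul_assoc, ← uexpect_const_mul (c := (9 : ℝ) ^ q) (Ω := Finset.univ)]
  rw [← uexpect_const hne (9 ^ q * _)]
  refine uexpect_mono fun i _ => (gradient_pow_le hq _ ω).trans ?_
  refine mul_le_mul_of_nonneg_left (uexpect_mono fun ε _ => ?_) (by positivity)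
  refine le_trans ?_ (gradient_pow_le hq _ ω)
  rw [pow_mul, ← mlPartial_dir]
  refine pow_le_pow_left₀ (sq_nonneg _) ?_ q
  exact Finset.single_le_sum (f := fun i => mlPoly (mlPartial i (mlDir (signMean ε) a)) ω ^ 2)
    (fun i _ => sq_nonneg _) (Finset.mem_univ i)

lemma add_pow_le_two_pow_mul {u v : ℝ} (hu : 0 ≤ u) (hv : 0 ≤ v) {q : ℕ} (hq : 1 ≤ q) :
    (u + v) ^ q ≤ 2 ^ q * (u ^ q + v ^ q) := by
  obtain ⟨m, rfl⟩ := Nat.exists_eq_add_of_le' hq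
  refine (add_pow_le hu hv (m + 1)).trans ?_
  refine mul_le_mul_of_nonneg_right ?_ (by positivity)
  exact pow_le_pow_right₀ (by norm_num) (by omega)

lemma gradient_hessian_pow_le {q : ℕ} (hq : 1 ≤ q) (X : ℝ) {G H G' H' : ℝ} (hG0 : 0 ≤ G)
    (hH0 : 0 ≤ H) (h1 : G ^ q ≤ 9 ^ q * G') (h2 : H ^ q ≤ 81 ^ q * H') (hG'0 : 0 ≤ G')
    (hH'0 : 0 ≤ H') :
    (8 * (q : ℝ)) ^ q * (6 * X ^ 2 * G + 3 * X ^ 4 * H) ^ q ≤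
      (1000 * q * X ^ 2) ^ q * G' + ((1000 * q * X ^ 2) ^ q) ^ 2 * H' := by
  have hq' : (1 : ℝ) ≤ q := by exact_mod_cast hq
  have hX2 : X ^ 4 = X ^ 2 * X ^ 2 := by ring
  have hx0 : 0 ≤ X ^ 2 := sq_nonneg X
  calc (8 * (q : ℝ)) ^ q * (6 * X ^ 2 * G + 3 * X ^ 4 * H) ^ q
      ≤ (8 * q) ^ q * (2 ^ q * ((6 * X ^ 2 * G) ^ q + (3 * X ^ 4 * H) ^ q)) := by
        gcongr
        exact add_pow_le_two_pow_mul (by positivity) (by positivity) hq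
    _ = (96 * q * X ^ 2) ^ q * G ^ q + (48 * q * X ^ 4) ^ q * H ^ q := by
        simp only [mul_add, ← mul_assoc, ← mul_pow]
        congr 2 <;> ring
    _ ≤ (96 * q * X ^ 2) ^ q * (9 ^ q * G') + (48 * q * X ^ 4) ^ q * (81 ^ q * H') := by
        gcongr
    _ = (864 * q * X ^ 2) ^ q * G' + (3888 * q * X ^ 4) ^ q * H' := by
        simp only [← mul_assoc, ← mul_pow]
        congr 3 <;> ring
    _ ≤ _ := by
        refine add_le_add ?_ ?_
        · gcongr
          norm_num
        · rw [← pow_mul, mul_comm q 2, pow_mul]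
          refine mul_le_mul_of_nonneg_right (pow_le_pow_left₀ (by positivity) ?_ q) hH'0
          rw [hX2]
          have : (3888 : ℝ) * q ≤ 1000 ^ 2 * q ^ 2 := by nlinarith
          calc (3888 : ℝ) * q * (X ^ 2 * X ^ 2) ≤ 1000 ^ 2 * q ^ 2 * (X ^ 2 * X ^ 2) := by gcongr
            _ = _ := by ring

lemma centered_moment_step (hM : (multislice L N κ x).Nonempty) {X : ℝ}
    (hX : ∀ i j, |x i - x j| ≤ X) (a : Finset (Fin N) → ℝ) {q : ℕ} (hq : 1 ≤ q) :
    (uexpect (multislice L N κ x) fun ω =>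
        (mlPoly a ω - uexpect (multislice L N κ x) (mlPoly a)) ^ (2 * q)) ≤
      (1000 * q * X ^ 2) ^ q * (uexpect Finset.univ fun ε : Fin N × Fin (2 * q) → Bool =>
        uexpect (multislice L N κ x) fun ω => mlPoly (mlDir (signMean ε) a) ω ^ (2 * q)) +
      ((1000 * q * X ^ 2) ^ q) ^ 2 * (uexpect Finset.univ fun ε : Fin N × Fin (2 * q) → Bool =>
        uexpect Finset.univ fun ε' : Fin N × Fin (2 * q) → Bool =>
          uexpect (multislice L N κ x) fun ω =>
            mlPoly (mlDir (signMean ε') (mlDir (signMean ε) a)) ω ^ (2 * q)) := by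
  set M := multislice L N κ x
  refine (multislice_moment_le hM hX a hq).trans ?_
  rw [uexpect_comm (Ω' := M), uexpect_congr (Ω := Finset.univ) fun ε _ => uexpect_comm Finset.univ M
    fun (ε' : Fin N × Fin (2 * q) → Bool) ω =>
      mlPoly (mlDir (signMean ε') (mlDir (signMean ε) a)) ω ^ (2 * q),
    uexpect_comm (Ω' := M), ← uexpect_const_mul, ← uexpect_const_mul,
    ← uexpect_const_mul, ← uexpect_add]
  refine uexpect_mono fun ω _ => ?_
  exact gradient_hessian_pow_le hq X (Finset.sum_nonneg fun i _ => sq_nonneg _)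
    (div_nonneg (Finset.sum_nonneg fun i _ => Finset.sum_nonneg fun j _ => sq_nonneg _)
      (Nat.cast_nonneg _)) (gradient_pow_le hq a ω) (hessian_pow_le hq a ω)
    (uexpect_nonneg fun _ _ => by rw [pow_mul]; positivity)
    (uexpect_nonneg fun _ _ => uexpect_nonneg fun _ _ => by rw [pow_mul]; positivity)

lemma mlPoly_zero_of_coeff {a : Finset (Fin N) → ℝ} (ha : ∀ S, a S = 0) (ω : Fin N → ℝ) :
    mlPoly a ω = 0 := by
  simp [mlPoly, ha]

/-- Centered moments are controlled by the chaoses of the mean derivatives, given the uncentered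
bounds for polynomials of lower degree. -/
lemma centered_moment_le_of_moment_le (hM : (multislice L N κ x).Nonempty) {X : ℝ}
    (hX : ∀ i j, |x i - x j| ≤ X) {q : ℕ} (hq : 1 ≤ q) (n : ℕ)
    (ih : ∀ m ≤ n, ∀ b : Finset (Fin N) → ℝ, (∀ S, m ≤ S.card → b S = 0) →
      (uexpect (multislice L N κ x) fun ω => mlPoly b ω ^ (2 * q)) ≤
        8 ^ (q * m) * ∑ k ∈ Finset.range m, ((1000 * q * X ^ 2) ^ q) ^ k *
          chaosMoment (multislice L N κ x) q k b)
    (a : Finset (Fin N) → ℝ) (ha : ∀ S, n + 1 ≤ S.card → a S = 0) :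
    (uexpect (multislice L N κ x) fun ω =>
        (mlPoly a ω - uexpect (multislice L N κ x) (mlPoly a)) ^ (2 * q)) ≤
      2 * 8 ^ (q * n) * ∑ k ∈ Finset.range n, ((1000 * q * X ^ 2) ^ q) ^ (k + 1) *
        chaosMoment (multislice L N κ x) q (k + 1) a := by
  refine (centered_moment_step hM hX a hq).trans ?_
  set M := multislice L N κ x
  set U := (1000 * (q : ℝ) * X ^ 2) ^ q with hU
  have hU0 : 0 ≤ U := by positivity
  have hd : ∀ v : Fin N → ℝ, ∀ S : Finset (Fin N), n ≤ S.card → mlDir v a S = 0 := mlDir_eq_zero ha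
  have hdd : ∀ v v' : Fin N → ℝ, ∀ S : Finset (Fin N), n - 1 ≤ S.card →
      mlDir v' (mlDir v a) S = 0 := fun v v' =>
    mlDir_eq_zero (fun S hS => hd v S (by omega)) v'
  have h1 : U * (uexpect Finset.univ fun ε : Fin N × Fin (2 * q) → Bool =>
      uexpect M fun ω => mlPoly (mlDir (signMean ε) a) ω ^ (2 * q)) ≤
      8 ^ (q * n) * ∑ k ∈ Finset.range n, U ^ (k + 1) * chaosMoment M q (k + 1) a := by
    refine (mul_le_mul_of_nonneg_left (uexpect_mono fun ε _ => ih n le_rfl _ (hd _)) hU0).trans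
      (le_of_eq ?_)
    rw [uexpect_const_mul, uexpect_sum, mul_left_comm, Finset.mul_sum]
    congr 1
    refine Finset.sum_congr rfl fun k _ => ?_
    rw [uexpect_const_mul, chaosMoment_succ]
    ring
  have h2 : U ^ 2 * (uexpect Finset.univ fun ε : Fin N × Fin (2 * q) → Bool =>
      uexpect Finset.univ fun ε' : Fin N × Fin (2 * q) → Bool =>
      uexpect M fun ω => mlPoly (mlDir (signMean ε') (mlDir (signMean ε) a)) ω ^ (2 * q)) ≤
      8 ^ (q * n) * ∑ k ∈ Finset.range n, U ^ (k + 1) * chaosMoment M q (k + 1) a := by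
    have h3 : U ^ 2 * (uexpect Finset.univ fun ε : Fin N × Fin (2 * q) → Bool =>
        uexpect Finset.univ fun ε' : Fin N × Fin (2 * q) → Bool =>
        uexpect M fun ω => mlPoly (mlDir (signMean ε') (mlDir (signMean ε) a)) ω ^ (2 * q)) ≤
        8 ^ (q * (n - 1)) *
          ∑ k ∈ Finset.range (n - 1), U ^ (k + 2) * chaosMoment M q (k + 2) a := by
      refine (mul_le_mul_of_nonneg_left (uexpect_mono fun ε _ => uexpect_mono fun ε' _ =>
        ih (n - 1) (by omega) _ (hdd _ _)) (pow_nonneg hU0 2)).trans (le_of_eq ?_)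
      simp only [uexpect_const_mul, uexpect_sum]
      rw [mul_left_comm, Finset.mul_sum]
      congr 1
      refine Finset.sum_congr rfl fun k _ => ?_
      rw [chaosMoment_succ, uexpect_congr fun ε _ => chaosMoment_succ M q k _]
      ring
    refine h3.trans ?_
    have hnn : ∀ k, 0 ≤ U ^ k * chaosMoment M q k a := fun k =>
      mul_nonneg (pow_nonneg hU0 k) (chaosMoment_nonneg _ _ _ _)
    refine mul_le_mul (pow_le_pow_right₀ (by norm_num) (Nat.mul_le_mul_left q (by omega))) ?_
      (Finset.sum_nonneg fun k _ => hnn (k + 2)) (by positivity)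
    rcases n with _ | n
    · simp
    · rw [Nat.add_sub_cancel, Finset.sum_range_succ' _ n]
      exact le_add_of_nonneg_right (hnn _)
  linarith

lemma moment_le_sum_chaosMoment (hM : (multislice L N κ x).Nonempty) {X : ℝ}
    (hX : ∀ i j, |x i - x j| ≤ X) {q : ℕ} (hq : 1 ≤ q) (n : ℕ) :
    ∀ a : Finset (Fin N) → ℝ, (∀ S, n ≤ S.card → a S = 0) →
      (uexpect (multislice L N κ x) fun ω => mlPoly a ω ^ (2 * q)) ≤
        8 ^ (q * n) * ∑ k ∈ Finset.range n, ((1000 * q * X ^ 2) ^ q) ^ k *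
          chaosMoment (multislice L N κ x) q k a := by
  induction n using Nat.strong_induction_on with
  | _ n ih =>
    intro a ha
    rcases n with _ | n
    · have h0 : ∀ ω, mlPoly a ω = 0 := mlPoly_zero_of_coeff fun S => ha S (Nat.zero_le _)
      simp [h0, uexpect_const hM, show q ≠ 0 by omega]
    have h := centered_moment_le_of_moment_le hM hX hq n (fun m hm => ih m (by omega)) a ha
    set M := multislice L N κ x
    set U := (1000 * (q : ℝ) * X ^ 2) ^ q with hU
    set e := uexpect M (mlPoly a) with he
    set T := ∑ k ∈ Finset.range n, U ^ (k + 1) * chaosMoment M q (k + 1) a with hT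
    have hT0 : 0 ≤ T := Finset.sum_nonneg fun k _ =>
      mul_nonneg (by positivity) (chaosMoment_nonneg _ _ _ _)
    have h2 : (uexpect M fun ω => mlPoly a ω ^ (2 * q)) ≤
        4 ^ q * ((uexpect M fun ω => (mlPoly a ω - e) ^ (2 * q)) + e ^ (2 * q)) := by
      rw [← uexpect_const hM (e ^ (2 * q)), ← uexpect_add, ← uexpect_const_mul]
      refine uexpect_mono fun ω _ => ?_
      have h3 : mlPoly a ω ^ 2 ≤ 2 * (mlPoly a ω - e) ^ 2 + 2 * e ^ 2 := by
        nlinarith [sq_nonneg (mlPoly a ω - 2 * e)]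
      rw [pow_mul, pow_mul, pow_mul]
      refine (pow_le_pow_left₀ (sq_nonneg _) h3 q).trans
        ((add_pow_le_two_pow_mul (by positivity) (by positivity) hq).trans (le_of_eq ?_))
      rw [mul_pow, mul_pow, ← mul_add, ← mul_assoc, ← mul_pow]
      norm_num
    have h4 : e ^ (2 * q) = chaosMoment M q 0 a := (chaosMoment_zero M q a).symm
    rw [Finset.sum_range_succ', ← hT, ← h4, pow_zero, one_mul]
    have he0 : 0 ≤ e ^ (2 * q) := by rw [pow_mul]; positivity
    have h8 : (1 : ℝ) ≤ 8 ^ (q * n) := one_le_pow₀ (by norm_num)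
    have h48 : (4 : ℝ) ^ q * 2 ≤ 8 ^ q := by
      calc (4 : ℝ) ^ q * 2 ≤ 4 ^ q * 2 ^ q := by
            gcongr
            calc (2 : ℝ) = 2 ^ 1 := by norm_num
              _ ≤ 2 ^ q := pow_le_pow_right₀ (by norm_num) hq
        _ = 8 ^ q := by rw [← mul_pow]; norm_num
    calc _ ≤ 4 ^ q * (2 * 8 ^ (q * n) * T + e ^ (2 * q)) := h2.trans (by gcongr)
      _ ≤ 4 ^ q * (2 * 8 ^ (q * n) * T + 2 * 8 ^ (q * n) * e ^ (2 * q)) := by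
          gcongr
          nlinarith
      _ = (4 ^ q * 2) * (8 ^ (q * n) * (T + e ^ (2 * q))) := by ring
      _ ≤ 8 ^ q * (8 ^ (q * n) * (T + e ^ (2 * q))) := by gcongr
      _ = _ := by ring

lemma centered_moment_le_sum_chaosMoment (hM : (multislice L N κ x).Nonempty) {X : ℝ}
    (hX : ∀ i j, |x i - x j| ≤ X) {q : ℕ} (hq : 1 ≤ q) (d : ℕ) (a : Finset (Fin N) → ℝ)
    (ha : ∀ S, d + 1 ≤ S.card → a S = 0) :
    (uexpect (multislice L N κ x) fun ω =>
        (mlPoly a ω - uexpect (multislice L N κ x) (mlPoly a)) ^ (2 * q)) ≤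
      2 * 8 ^ (q * d) * ∑ k ∈ Finset.range d, ((1000 * q * X ^ 2) ^ q) ^ (k + 1) *
        chaosMoment (multislice L N κ x) q (k + 1) a :=
  centered_moment_le_of_moment_le hM hX hq d
    (fun m _ => moment_le_sum_chaosMoment hM hX hq m) a ha

end ChaosExpansion

section BlockTilt

lemma uexpect_pi_prod {β : Type*} [Fintype β] [DecidableEq β] {Ω : β → Type*}
    [∀ b, Fintype (Ω b)] [∀ b, Nonempty (Ω b)] (s : Finset β) (F : ∀ b, Ω b → ℝ) :
    (uexpect Finset.univ fun ω : ∀ b, Ω b => ∏ b ∈ s, F b (ω b)) =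
      ∏ b ∈ s, uexpect Finset.univ (F b) := by
  have h1 : ∀ ω : ∀ b, Ω b, ∏ b ∈ s, F b (ω b) = ∏ b, if b ∈ s then F b (ω b) else 1 :=
    fun ω => by rw [Finset.prod_ite_mem, Finset.univ_inter]
  have h2 : ∏ b ∈ s, uexpect Finset.univ (F b) =
      ∏ b, uexpect Finset.univ fun ω => if b ∈ s then F b ω else 1 := by
    rw [← Finset.univ_inter s, ← Finset.prod_ite_mem]
    refine Finset.prod_congr rfl fun b _ => ?_
    by_cases hb : b ∈ s
    · simp [hb]
    · simp [hb, uexpect_const Finset.univ_nonempty]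
  rw [h2]
  simp only [h1, uexpect, Finset.prod_div_distrib]
  rw [Finset.prod_univ_sum, Fintype.piFinset_univ, Finset.card_univ, Fintype.card_pi,
    Nat.cast_prod]
  rfl

lemma uexpect_update {β Ω : Type*} [Fintype β] [DecidableEq β] [Fintype Ω] [Nonempty Ω] (b : β)
    (F : (β → Ω) → ℝ) :
    uexpect Finset.univ F =
      uexpect Finset.univ fun g => uexpect Finset.univ fun γ => F (Function.update g b γ) := by
  have h : ∑ g : β → Ω, ∑ γ : Ω, F (Function.update g b γ) = ∑ g : β → Ω, ∑ _γ : Ω, F g := by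
    have hinv : Function.Involutive fun z : (β → Ω) × Ω => (Function.update z.1 b z.2, z.1 b) :=
      fun z => by simp
    rw [← Fintype.sum_prod_type', ← Fintype.sum_prod_type']
    exact Equiv.sum_comp (Function.Involutive.toPerm _ hinv) fun z : (β → Ω) × Ω => F z.1
  simp only [uexpect, ← Finset.sum_div, h]
  have h0 : (Fintype.card Ω : ℝ) ≠ 0 := by exact_mod_cast Fintype.card_ne_zero
  simp only [Finset.sum_const, Finset.card_univ, nsmul_eq_mul, ← Finset.mul_sum]
  field_simp

variable {β : Type*} [Fintype β] [DecidableEq β] {ι : β → Type*} [∀ b, Fintype (ι b)]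
  [∀ b, DecidableEq (ι b)] {p : ℕ}

/-- The product of the tilting densities of a family of vectors. -/
def blockTilt (s : Finset β) (u : ∀ b, ι b → ℝ) (ε : ∀ b, ι b × Fin p → Bool) : ℝ :=
  ∏ b ∈ s, meanTilt (u b) (ε b)

lemma blockTilt_nonneg {s : Finset β} {u : ∀ b, ι b → ℝ} (hu : ∀ b ∈ s, ∑ i, u b i ^ 2 ≤ 1)
    (ε : ∀ b, ι b × Fin p → Bool) : 0 ≤ blockTilt s u ε :=
  Finset.prod_nonneg fun b hb => meanTilt_nonneg (hu b hb) _

lemma uexpect_blockTilt (s : Finset β) (u : ∀ b, ι b → ℝ) :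
    uexpect Finset.univ (blockTilt s u : (∀ b, ι b × Fin p → Bool) → ℝ) = 1 := by
  refine (uexpect_pi_prod s fun b => meanTilt (u b)).trans ?_
  exact Finset.prod_eq_one fun b _ => uexpect_meanTilt _

lemma uexpect_blockTilt_sq_le {s : Finset β} {u : ∀ b, ι b → ℝ}
    (hu : ∀ b ∈ s, ∑ i, u b i ^ 2 ≤ 1) :
    (uexpect Finset.univ fun ε : ∀ b, ι b × Fin p → Bool => blockTilt s u ε ^ 2) ≤
      Real.exp p ^ s.card := by
  simp only [blockTilt, ← Finset.prod_pow]
  rw [uexpect_pi_prod s fun b ε => meanTilt (u b) ε ^ 2]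
  refine (Finset.prod_le_prod (fun b _ => uexpect_nonneg fun _ _ => sq_nonneg _)
    fun b hb => uexpect_meanTilt_sq_le (hu b hb)).trans ?_
  rw [Finset.prod_const]

lemma uexpect_blockTilt_mul (hp : 1 ≤ p) (s : Finset β) (u : ∀ b, ι b → ℝ) (y : ∀ b, ι b) :
    (uexpect Finset.univ fun ε : ∀ b, ι b × Fin p → Bool =>
      blockTilt s u ε * ∏ b ∈ s, signMean (ε b) (y b)) = ∏ b ∈ s, u b (y b) := by
  simp only [blockTilt, ← Finset.prod_mul_distrib]
  rw [uexpect_pi_prod s fun b ε => meanTilt (u b) ε * signMean ε (y b)]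
  exact Finset.prod_congr rfl fun b _ => uexpect_meanTilt_mul hp _ _

lemma uexpect_blockTilt_mul_mul (hp : 1 ≤ p) (s : Finset β) (u : ∀ b, ι b → ℝ)
    (y y' : ∀ b, ι b) :
    (uexpect Finset.univ fun ε : ∀ b, ι b × Fin p → Bool =>
      blockTilt s u ε * ((∏ b ∈ s, signMean (ε b) (y b)) * ∏ b ∈ s, signMean (ε b) (y' b))) =
      ∏ b ∈ s, (u b (y b) * u b (y' b) +
        if y b = y' b then (1 - u b (y b) ^ 2) / p else 0) := by
  simp only [blockTilt, ← Finset.prod_mul_distrib]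
  rw [uexpect_pi_prod s fun b ε =>
    meanTilt (u b) ε * (signMean ε (y b) * signMean ε (y' b))]
  exact Finset.prod_congr rfl fun b _ => uexpect_meanTilt_mul_mul hp _ _ _

lemma sum_sum_fiber_le {α ζ : Type*} [Fintype α] [Fintype ζ] [DecidableEq ζ] (κ : α → ζ)
    (b c : α → ℝ) (hc1 : ∀ i, c i ≤ 1)
    (hc : ∀ i j, κ i = κ j → c i = c j) :
    ∑ i, ∑ j, (if κ i = κ j then c i * (b i * b j) else 0) ≤
      ∑ z, (∑ i, if κ i = z then b i else 0) ^ 2 := by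
  have h : ∀ i j, (if κ i = κ j then c i * (b i * b j) else 0) =
      ∑ z, if κ i = z then (if κ j = z then c i * (b i * b j) else 0) else 0 := fun i j => by
    rw [Finset.sum_ite_eq Finset.univ (κ i)]
    simp [eq_comm]
  simp only [h]
  rw [Finset.sum_congr rfl fun i _ => Finset.sum_comm, Finset.sum_comm]
  refine Finset.sum_le_sum fun z _ => ?_
  by_cases hz : ∃ i, κ i = z
  · obtain ⟨i₀, hi₀⟩ := hz
    have e : ∑ i, ∑ j, (if κ i = z then (if κ j = z then c i * (b i * b j) else 0) else 0) =
        c i₀ * (∑ i, if κ i = z then b i else 0) ^ 2 := by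
      rw [sq, Finset.sum_mul_sum, Finset.mul_sum]
      refine Finset.sum_congr rfl fun i _ => ?_
      rw [Finset.mul_sum]
      refine Finset.sum_congr rfl fun j _ => ?_
      by_cases h1 : κ i = z <;> by_cases h2 : κ j = z
      · simp [h1, h2, hc i i₀ (h1.trans hi₀.symm)]
      all_goals simp [h1, h2]
    rw [e]
    exact mul_le_of_le_one_left (sq_nonneg _) (hc1 i₀)
  · push Not at hz
    simp [hz]

/-- The partial contraction of a tensor with a family of block vectors, one index being free. -/
def contraction {α ν : Type*} [Fintype α] [DecidableEq ν] (s : Finset β) (a : α → ℝ)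
    (y : α → ∀ b, ι b) (κ : α → ν) (u : ∀ b, ι b → ℝ) (z : ν) : ℝ :=
  ∑ i, if κ i = z then a i * ∏ b ∈ s, u b (y i b) else 0

lemma sum_contraction_mul {α ν : Type*} [Fintype α] [Fintype ν] [DecidableEq ν] (s : Finset β)
    (a : α → ℝ) (y : α → ∀ b, ι b) (κ : α → ν) (u : ∀ b, ι b → ℝ) (v : ν → ℝ) :
    ∑ z, contraction s a y κ u z * v z = ∑ i, a i * (∏ b ∈ s, u b (y i b)) * v (κ i) := by
  simp only [contraction, Finset.sum_mul]
  rw [Finset.sum_comm]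
  refine Finset.sum_congr rfl fun i _ => ?_
  simp only [ite_mul, zero_mul]
  rw [Finset.sum_ite_eq]
  simp

lemma uexpect_blockTilt_contraction_mul (hp : 1 ≤ p) {α ν : Type*} [Fintype α] [Fintype ν]
    [DecidableEq ν] (s : Finset β) (a : α → ℝ) (y : α → ∀ b, ι b) (κ : α → ν) (u : ∀ b, ι b → ℝ)
    (v : ν → ℝ) :
    (uexpect Finset.univ fun ε : ∀ b, ι b × Fin p → Bool => blockTilt s u ε *
      ∑ z, contraction s a y κ (fun b => signMean (ε b)) z * v z) =
      ∑ z, contraction s a y κ u z * v z := by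
  simp only [sum_contraction_mul, Finset.mul_sum]
  rw [uexpect_sum]
  refine Finset.sum_congr rfl fun i _ => ?_
  rw [← uexpect_blockTilt_mul hp s u (y i), ← uexpect_const_mul, ← uexpect_mul_const]
  exact uexpect_congr fun ε _ => by ring

lemma uexpect_blockTilt_norm_contraction_le (hp : 1 ≤ p) {α ν : Type*} [Fintype α] [Fintype ν]
    [DecidableEq ν] {s : Finset β} (a : α → ℝ) (y : α → ∀ b, ι b) (κ : α → ν) {u : ∀ b, ι b → ℝ}
    (hu : ∀ b ∈ s, ∑ i, u b i ^ 2 ≤ 1) {ζ : Finset β → Type*} [∀ t, Fintype (ζ t)]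
    [∀ t, DecidableEq (ζ t)] (θ : ∀ t, α → ζ t)
    (hθ : ∀ t ⊆ s, ∀ i j, θ t i = θ t j ↔ κ i = κ j ∧ ∀ b ∈ t, y i b = y j b) :
    (uexpect Finset.univ fun ε : ∀ b, ι b × Fin p → Bool => blockTilt s u ε *
      ∑ z, contraction s a y κ (fun b => signMean (ε b)) z ^ 2) ≤
      ∑ t ∈ s.powerset, ((p : ℝ)⁻¹) ^ t.card *
        ∑ z, contraction (s \ t) a y (θ t) u z ^ 2 := by
  have h1 : ∀ w : ∀ b, ι b → ℝ, ∑ z, contraction s a y κ w z ^ 2 =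
      ∑ i, ∑ j, if κ i = κ j then a i * a j *
        ((∏ b ∈ s, w b (y i b)) * ∏ b ∈ s, w b (y j b)) else 0 := fun w => by
    have e : ∀ i j, (if κ i = κ j then a i * a j *
        ((∏ b ∈ s, w b (y i b)) * ∏ b ∈ s, w b (y j b)) else 0) = ∑ z,
        (if κ i = z then a i * ∏ b ∈ s, w b (y i b) else 0) *
          if κ j = z then a j * ∏ b ∈ s, w b (y j b) else 0 := fun i j => by
      simp only [ite_mul, zero_mul]
      rw [Finset.sum_ite_eq Finset.univ (κ i)]
      simp only [Finset.mem_univ, if_true, eq_comm (a := κ j)]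
      split_ifs <;> ring
    simp only [e]
    rw [Finset.sum_congr rfl fun i _ => Finset.sum_comm, Finset.sum_comm]
    refine Finset.sum_congr rfl fun z _ => ?_
    rw [sq, contraction, Finset.sum_mul_sum]
  have h2 : (uexpect Finset.univ fun ε : ∀ b, ι b × Fin p → Bool => blockTilt s u ε *
      ∑ z, contraction s a y κ (fun b => signMean (ε b)) z ^ 2) =
      ∑ i, ∑ j, if κ i = κ j then a i * a j * ∏ b ∈ s, (u b (y i b) * u b (y j b) +
        if y i b = y j b then (1 - u b (y i b) ^ 2) / p else 0) else 0 := by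
    simp only [h1, Finset.mul_sum]
    rw [uexpect_sum]
    refine Finset.sum_congr rfl fun i _ => ?_
    rw [uexpect_sum]
    refine Finset.sum_congr rfl fun j _ => ?_
    split_ifs with h
    · rw [← uexpect_blockTilt_mul_mul hp s u (y i) (y j), ← uexpect_const_mul]
      exact uexpect_congr fun ε _ => by ring
    · simp [uexpect_const Finset.univ_nonempty]
  have h3 : ∀ i j, (if κ i = κ j then a i * a j * ∏ b ∈ s, (u b (y i b) * u b (y j b) +
        if y i b = y j b then (1 - u b (y i b) ^ 2) / p else 0) else 0) =
      ∑ t ∈ s.powerset, ((p : ℝ)⁻¹) ^ t.card * if θ t i = θ t j then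
        (∏ b ∈ t, (1 - u b (y i b) ^ 2)) * ((a i * ∏ b ∈ s \ t, u b (y i b)) *
          (a j * ∏ b ∈ s \ t, u b (y j b))) else 0 := fun i j => by
    simp only [add_comm (u _ _ * u _ _)]
    rw [Finset.prod_add]
    split_ifs with h
    · rw [Finset.mul_sum]
      refine Finset.sum_congr rfl fun t ht => ?_
      have ht' := Finset.mem_powerset.1 ht
      by_cases h' : ∀ b ∈ t, y i b = y j b
      · rw [if_pos ((hθ t ht' i j).2 ⟨h, h'⟩), Finset.prod_congr rfl fun b hb => if_pos (h' b hb),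
          Finset.prod_mul_distrib]
        simp only [div_eq_mul_inv]
        rw [Finset.prod_mul_distrib, Finset.prod_const]
        ring
      · rw [if_neg fun hh => h' ((hθ t ht' i j).1 hh).2]
        push Not at h'
        obtain ⟨b, hb, hne⟩ := h'
        rw [Finset.prod_eq_zero hb (if_neg hne)]
        ring
    · refine (Finset.sum_eq_zero fun t ht => ?_).symm
      rw [if_neg fun hh => h ((hθ t (Finset.mem_powerset.1 ht) i j).1 hh).1, mul_zero]
  rw [h2]
  simp only [h3]
  rw [Finset.sum_congr rfl fun i _ => Finset.sum_comm, Finset.sum_comm]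
  refine Finset.sum_le_sum fun t ht => ?_
  have ht' := Finset.mem_powerset.1 ht
  simp only [← Finset.mul_sum]
  refine mul_le_mul_of_nonneg_left ?_ (by positivity)
  have hle : ∀ i, ∀ b ∈ t, u b (y i b) ^ 2 ≤ 1 := fun i b hb =>
    (Finset.single_le_sum (f := fun j => u b j ^ 2) (fun j _ => sq_nonneg _)
      (Finset.mem_univ (y i b))).trans (hu b (ht' hb))
  refine sum_sum_fiber_le (θ t) (fun i => a i * ∏ b ∈ s \ t, u b (y i b))
    (fun i => ∏ b ∈ t, (1 - u b (y i b) ^ 2)) (fun i => ?_) fun i j hij => ?_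
  · exact Finset.prod_le_one (fun b hb => sub_nonneg.2 (hle i b hb))
      fun b hb => sub_le_self _ (sq_nonneg _)
  · exact Finset.prod_congr rfl fun b hb => by rw [((hθ t ht' i j).1 hij).2 b hb]

/-- The squared scalar product with the direction of `v`. -/
def directionSq {ν : Type*} [Fintype ν] (v e : ν → ℝ) : ℝ := (∑ i, v i * e i) ^ 2 / ∑ i, v i ^ 2

lemma directionSq_nonneg {ν : Type*} [Fintype ν] (v e : ν → ℝ) : 0 ≤ directionSq v e :=
  div_nonneg (sq_nonneg _) (Finset.sum_nonneg fun _ _ => sq_nonneg _)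

lemma sq_sum_eq_mul_directionSq {ν : Type*} [Fintype ν] (v e : ν → ℝ) :
    (∑ i, v i * e i) ^ 2 = (∑ i, v i ^ 2) * directionSq v e := by
  by_cases h : ∑ i, v i ^ 2 = 0
  · have hv : ∀ i, v i = 0 := fun i => by
      have := (Finset.sum_eq_zero_iff_of_nonneg fun i _ => sq_nonneg (v i)).1 h i
        (Finset.mem_univ i)
      exact pow_eq_zero_iff (two_ne_zero) |>.1 this
    simp [hv]
  · rw [directionSq, mul_div_cancel₀ _ h]

lemma uexpect_directionSq_pow_le {ν : Type*} [Fintype ν] [DecidableEq ν] {q : ℕ} (hq : 1 ≤ q)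
    (v : ν → ℝ) :
    (uexpect Finset.univ fun γ : ν × Fin (2 * q) → Bool =>
      directionSq v (signMean γ) ^ (2 * q)) ≤ 12 ^ (2 * q) := by
  simp only [directionSq, div_pow, ← pow_mul]
  simp only [div_eq_mul_inv _ ((∑ i, v i ^ 2) ^ _)]
  rw [uexpect_mul_const, ← div_eq_mul_inv]
  have h := khintchine_signMean (p := 2 * q) (by omega) v (2 * q)
  have hq' : ((2 * q : ℕ) : ℝ) ≠ 0 := by positivity
  rw [mul_div_cancel_right₀ _ hq', mul_pow] at h
  exact div_le_of_le_mul₀ (pow_nonneg (Finset.sum_nonneg fun _ _ => sq_nonneg _) _)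
    (by positivity) h

lemma sum_contraction_mul_pow_le {q : ℕ} (hq : 1 ≤ q) {α ν : Type*} [Fintype α] [Fintype ν]
    [DecidableEq ν] {s : Finset β} (a : α → ℝ) (y : α → ∀ b, ι b) (κ : α → ν) {u : ∀ b, ι b → ℝ}
    (hu : ∀ b ∈ s, ∑ i, u b i ^ 2 ≤ 1) {ζ : Finset β → Type*} [∀ t, Fintype (ζ t)]
    [∀ t, DecidableEq (ζ t)] (θ : ∀ t, α → ζ t)
    (hθ : ∀ t ⊆ s, ∀ i j, θ t i = θ t j ↔ κ i = κ j ∧ ∀ b ∈ t, y i b = y j b) (v : ν → ℝ) :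
    (∑ z, contraction s a y κ u z * v z) ^ (2 * q) ≤
      (∑ t ∈ s.powerset, (((2 * q : ℕ) : ℝ)⁻¹) ^ t.card *
        ∑ z, contraction (s \ t) a y (θ t) u z ^ 2) ^ q *
      ((((9 : ℝ) ^ s.card) ^ q / (12 * 3 ^ s.card) ^ q *
        (uexpect Finset.univ fun ε : ∀ b, ι b × Fin (2 * q) → Bool =>
          directionSq (contraction s a y κ fun b => signMean (ε b)) v ^ (2 * q)) +
        (12 * 3 ^ s.card) ^ q) / 2) := by
  set D : (∀ b, ι b × Fin (2 * q) → Bool) → ℝ := fun ε =>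
    ∑ z, contraction s a y κ (fun b => signMean (ε b)) z ^ 2 with hD
  set h : (∀ b, ι b × Fin (2 * q) → Bool) → ℝ := fun ε =>
    directionSq (contraction s a y κ fun b => signMean (ε b)) v with hh
  have hp : 1 ≤ 2 * q := by omega
  have hW0 : ∀ ε : ∀ b, ι b × Fin (2 * q) → Bool, 0 ≤ blockTilt s u ε := blockTilt_nonneg hu
  have hh0 : ∀ ε, 0 ≤ h ε := fun ε => directionSq_nonneg _ _
  have hD0 : ∀ ε, 0 ≤ D ε := fun ε => Finset.sum_nonneg fun _ _ => sq_nonneg _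
  have hDE := uexpect_blockTilt_norm_contraction_le hp a y κ hu θ hθ
  set S := ∑ t ∈ s.powerset, (((2 * q : ℕ) : ℝ)⁻¹) ^ t.card *
        ∑ z, contraction (s \ t) a y (θ t) u z ^ 2 with hS
  have h1 : (∑ z, contraction s a y κ u z * v z) ^ 2 ≤
      S * uexpect Finset.univ fun ε => blockTilt s u ε * h ε := by
    refine le_trans ?_ (mul_le_mul_of_nonneg_right hDE
      (uexpect_nonneg fun ε _ => mul_nonneg (hW0 ε) (hh0 ε)))
    rw [← uexpect_blockTilt_contraction_mul hp]
    unfold uexpect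
    rw [div_pow, div_mul_div_comm, ← sq]
    refine div_le_div_of_nonneg_right ?_ (by positivity)
    refine Finset.sum_sq_le_sum_mul_sum_of_sq_le_mul _ (fun ε _ => mul_nonneg (hW0 ε) (hD0 ε))
      (fun ε _ => mul_nonneg (hW0 ε) (hh0 ε)) fun ε _ => ?_
    rw [mul_pow, sq_sum_eq_mul_directionSq]
    exact le_of_eq (by ring)
  have hS0 : 0 ≤ S := (uexpect_nonneg fun ε _ => mul_nonneg (hW0 ε) (hD0 ε)).trans hDE
  set e := uexpect Finset.univ fun ε => blockTilt s u ε * h ε with he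
  have he0 : 0 ≤ e := uexpect_nonneg fun ε _ => mul_nonneg (hW0 ε) (hh0 ε)
  have h9 : Real.exp ((2 * q : ℕ) : ℝ) ^ s.card ≤ ((9 : ℝ) ^ s.card) ^ q := by
    rw [← pow_mul, mul_comm s.card, pow_mul]
    refine pow_le_pow_left₀ (Real.exp_pos _).le ?_ _
    push_cast
    rw [mul_comm, Real.exp_nat_mul]
    refine pow_le_pow_left₀ (Real.exp_pos _).le ?_ q
    have h : Real.exp 2 = Real.exp 1 ^ 2 := by rw [← Real.exp_nat_mul]; norm_num
    rw [h]
    have := Real.exp_one_lt_d9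
    have h0 := Real.exp_pos 1
    nlinarith
  have h2 : e ^ (2 * q) ≤ ((9 : ℝ) ^ s.card) ^ q * uexpect Finset.univ fun ε => h ε ^ (2 * q) := by
    refine (uexpect_density_pow_le (fun ε _ => hW0 ε) (uexpect_blockTilt s u)
      (fun ε _ => hh0 ε) q).trans ?_
    exact mul_le_mul_of_nonneg_right ((uexpect_blockTilt_sq_le hu).trans h9)
      (uexpect_nonneg fun ε _ => pow_nonneg (hh0 ε) _)
  rw [pow_mul]
  refine (pow_le_pow_left₀ (sq_nonneg _) h1 q).trans ?_
  rw [mul_pow]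
  refine mul_le_mul_of_nonneg_left ?_ (pow_nonneg hS0 q)
  set l := ((12 : ℝ) * 3 ^ s.card) ^ q with hl
  have hl0 : 0 < l := by positivity
  have h3 : e ^ q ≤ ((e ^ q) ^ 2 / l + l) / 2 := by
    rw [le_div_iff₀ two_pos, div_add' _ _ _ hl0.ne', le_div_iff₀ hl0]
    nlinarith [sq_nonneg (e ^ q - l)]
  refine h3.trans ?_
  rw [← pow_mul, mul_comm q 2, div_mul_eq_mul_div]
  gcongr

end BlockTilt

section ChaosBound

variable {k N : ℕ}

lemma tensorNorm_bddAbove (A : (Fin k → Fin N) → ℝ)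
    (P : Finpartition (Finset.univ : Finset (Fin k))) :
    BddAbove { r | ∃ xv : ∀ I : Finset (Fin k), (↥I → Fin N) → ℝ,
      (∀ I ∈ P.parts, ∑ y : ↥I → Fin N, (xv I y) ^ 2 ≤ 1) ∧
      r = ∑ idx : Fin k → Fin N, A idx * ∏ I ∈ P.parts.attach, xv I.1 (fun m => idx m.1) } := by
  refine ⟨∑ idx, |A idx|, ?_⟩
  rintro r ⟨xv, hxv, rfl⟩
  refine Finset.sum_le_sum fun idx _ => (le_abs_self _).trans ?_
  rw [abs_mul, Finset.abs_prod]
  refine mul_le_of_le_one_right (abs_nonneg _) (Finset.prod_le_one (fun _ _ => abs_nonneg _) ?_)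
  intro I _
  refine (sq_le_one_iff_abs_le_one _).1 ((Finset.single_le_sum
    (f := fun y => xv I.1 y ^ 2) (fun _ _ => sq_nonneg _) (Finset.mem_univ _)).trans (hxv I.1 I.2))

lemma le_tensorNorm (A : (Fin k → Fin N) → ℝ)
    (P : Finpartition (Finset.univ : Finset (Fin k))) {u : ∀ I : Finset (Fin k), (↥I → Fin N) → ℝ}
    (hu : ∀ I ∈ P.parts, ∑ y : ↥I → Fin N, (u I y) ^ 2 ≤ 1) :
    ∑ idx : Fin k → Fin N, A idx * ∏ I ∈ P.parts, u I (fun m => idx m.1) ≤ tensorNorm A P := by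
  refine le_csSup (tensorNorm_bddAbove A P) ⟨u, hu, ?_⟩
  exact Finset.sum_congr rfl fun idx _ => by
    rw [Finset.prod_attach P.parts fun I => u I fun m => idx m.1]

lemma tensorNorm_nonneg (A : (Fin k → Fin N) → ℝ) (hk : 1 ≤ k)
    (P : Finpartition (Finset.univ : Finset (Fin k))) : 0 ≤ tensorNorm A P := by
  have h := le_tensorNorm A P (u := fun _ _ => 0) (by simp)
  have hne : P.parts.Nonempty := P.parts_nonempty (by
    have : (Finset.univ : Finset (Fin k)).Nonempty := ⟨⟨0, hk⟩, Finset.mem_univ _⟩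
    exact this.ne_empty)
  simpa [Finset.prod_const, hne.card_pos.ne'] using h

lemma abs_le_tensorNorm (A : (Fin k → Fin N) → ℝ) (hk : 1 ≤ k)
    (P : Finpartition (Finset.univ : Finset (Fin k))) {u : ∀ I : Finset (Fin k), (↥I → Fin N) → ℝ}
    (hu : ∀ I ∈ P.parts, ∑ y : ↥I → Fin N, (u I y) ^ 2 ≤ 1) :
    |∑ idx : Fin k → Fin N, A idx * ∏ I ∈ P.parts, u I (fun m => idx m.1)| ≤ tensorNorm A P := by
  refine abs_le'.2 ⟨le_tensorNorm A P hu, ?_⟩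
  have hne : P.parts.Nonempty := P.parts_nonempty (by
    have : (Finset.univ : Finset (Fin k)).Nonempty := ⟨⟨0, hk⟩, Finset.mem_univ _⟩
    exact this.ne_empty)
  obtain ⟨J, hJ⟩ := hne
  have h := le_tensorNorm A P (u := Function.update u J (-u J)) fun I hI => by
    by_cases h : I = J
    · subst h
      simpa using hu I hI
    · simpa [h] using hu I hI
  refine le_trans (le_of_eq ?_) h
  rw [← Finset.sum_neg_distrib]
  refine Finset.sum_congr rfl fun idx _ => ?_
  have e : ∏ I ∈ P.parts.erase J, Function.update u J (-u J) I (fun m => idx m) =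
      ∏ I ∈ P.parts.erase J, u I fun m => idx m := Finset.prod_congr rfl fun I hI => by
    rw [Function.update_of_ne (Finset.ne_of_mem_erase hI)]
  rw [← Finset.mul_prod_erase _ _ hJ, ← Finset.mul_prod_erase P.parts _ hJ, Function.update_self, e]
  simp

variable {q : ℕ}

/-- A tensor evaluated at block vectors `u J`, `J ∈ s`, and at random vectors for the indices in
`R`. -/
def blockForm (A : (Fin k → Fin N) → ℝ) (s : Finset (Finset (Fin k))) (R : Finset (Fin k))
    (u : ∀ J : Finset (Fin k), (↥J → Fin N) → ℝ) (g : Fin k → Fin N × Fin (2 * q) → Bool) : ℝ :=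
  ∑ idx : Fin k → Fin N, A idx * (∏ J ∈ s, u J fun m => idx m) *
    ∏ r ∈ R, signMean (g r) (idx r)

/-- The tensor multiplied by the random vectors for the indices in `R`. -/
def weightedTensor (A : (Fin k → Fin N) → ℝ) (R : Finset (Fin k))
    (g : Fin k → Fin N × Fin (2 * q) → Bool) (idx : Fin k → Fin N) : ℝ :=
  A idx * ∏ r ∈ R, signMean (g r) (idx r)

/-- The restriction of a multi-index to a block. -/
def blockIndex (idx : Fin k → Fin N) (J : Finset (Fin k)) : ↥J → Fin N := fun m => idx m

lemma blockForm_eq_sum_contraction (A : (Fin k → Fin N) → ℝ) (s : Finset (Finset (Fin k)))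
    {R : Finset (Fin k)} {r : Fin k} (hr : r ∈ R) (u : ∀ J : Finset (Fin k), (↥J → Fin N) → ℝ)
    (g : Fin k → Fin N × Fin (2 * q) → Bool) :
    blockForm A s R u g = ∑ z, contraction (ι := fun J : Finset (Fin k) => ↥J → Fin N) s
      (weightedTensor A (R.erase r) g) blockIndex (fun idx => idx r) u z * signMean (g r) z := by
  rw [sum_contraction_mul]
  refine Finset.sum_congr rfl fun idx _ => ?_
  rw [← Finset.mul_prod_erase _ _ hr, weightedTensor]
  unfold blockIndex
  ring

lemma sum_contraction_mul_eq_blockForm (A : (Fin k → Fin N) → ℝ) (s : Finset (Finset (Fin k)))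
    (R K : Finset (Fin k)) (hK : K ∉ s) (u : ∀ J : Finset (Fin k), (↥J → Fin N) → ℝ)
    (g : Fin k → Fin N × Fin (2 * q) → Bool) (v : (↥K → Fin N) → ℝ) :
    ∑ z, contraction (ι := fun J : Finset (Fin k) => ↥J → Fin N) s (weightedTensor A R g)
      blockIndex (fun idx => blockIndex idx K) u z * v z =
      blockForm A (insert K s) R (Function.update u K v) g := by
  rw [sum_contraction_mul]
  refine Finset.sum_congr rfl fun idx _ => ?_
  have e : ∏ J ∈ s, Function.update u K v J (fun m => idx m) = ∏ J ∈ s, u J fun m => idx m :=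
    Finset.prod_congr rfl fun J hJ => by
      rw [Function.update_of_ne (ne_of_mem_of_not_mem hJ hK)]
  rw [Finset.prod_insert hK, Function.update_self, e, weightedTensor]
  unfold blockIndex
  ring

lemma sum_sq_pow_le_of_forall {ν : Type*} [Fintype ν] (w : ν → ℝ) (hq : 1 ≤ q) {Y : ℝ}
    (hY : 0 ≤ Y) (h : ∀ v : ν → ℝ, ∑ z, v z ^ 2 ≤ 1 → (∑ z, w z * v z) ^ (2 * q) ≤ Y) :
    (∑ z, w z ^ 2) ^ q ≤ Y := by
  set V := ∑ z, w z ^ 2 with hV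
  have hV0 : 0 ≤ V := Finset.sum_nonneg fun i _ => sq_nonneg _
  rcases hV0.eq_or_lt with h0 | hpos
  · rwa [← h0, zero_pow (by omega)]
  have hs : √V ^ 2 = V := Real.sq_sqrt hV0
  have hs0 : 0 < √V := Real.sqrt_pos.2 hpos
  have h1 := h (fun z => w z / √V) (by
    simp only [div_pow, hs, ← Finset.sum_div]
    exact div_self_le_one _)
  have h2 : ∑ z, w z * (w z / √V) = √V := by
    simp only [mul_div_assoc', ← Finset.sum_div, ← sq]
    rw [← hV, div_eq_iff hs0.ne', ← sq, hs]
  rwa [h2, pow_mul, hs] at h1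

lemma sum_pow_le_card_pow_mul {α : Type*} (s : Finset α) {c : α → ℝ} (hc : ∀ i ∈ s, 0 ≤ c i)
    (q : ℕ) (hs : s.Nonempty) : (∑ i ∈ s, c i) ^ q ≤ (s.card : ℝ) ^ q * ∑ i ∈ s, c i ^ q := by
  have h := uexpect_pow_le hs hc q
  have h1 : (1 : ℝ) ≤ s.card := by exact_mod_cast hs.card_pos
  unfold uexpect at h
  rw [div_pow, div_le_iff₀ (by positivity)] at h
  refine h.trans ?_
  rw [mul_comm]
  exact mul_le_mul_of_nonneg_left (div_le_self (Finset.sum_nonneg fun i hi =>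
    pow_nonneg (hc i hi) _) h1) (by positivity)

lemma exists_blockForm_pow_le_base (A : (Fin k → Fin N) → ℝ) (hk : 1 ≤ k) (hq : 1 ≤ q) {B : ℝ}
    (hB : ∀ P : Finpartition (Finset.univ : Finset (Fin k)),
      tensorNorm A P ^ 2 * ((2 * q : ℕ) : ℝ) ^ P.parts.card ≤ B)
    (s : Finset (Finset (Fin k))) (hs : (s : Set (Finset (Fin k))).PairwiseDisjoint id)
    (hbot : ∅ ∉ s) (hsup : s.sup id = Finset.univ) :
    ∃ Y : ℝ, 0 ≤ Y ∧ (∀ u : ∀ J : Finset (Fin k), (↥J → Fin N) → ℝ,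
        (∀ J ∈ s, ∑ y, u J y ^ 2 ≤ 1) → ∀ g : Fin k → Fin N × Fin (2 * q) → Bool,
          blockForm A s ∅ u g ^ (2 * q) ≤ Y) ∧ Y ≤ (B / ((2 * q : ℕ) : ℝ) ^ s.card) ^ q := by
  let P : Finpartition (Finset.univ : Finset (Fin k)) :=
    { parts := s
      supIndep := Finset.supIndep_iff_pairwiseDisjoint.2 hs
      sup_parts := hsup
      bot_notMem := hbot }
  refine ⟨(tensorNorm A P ^ 2) ^ q, by positivity, fun u hu g => ?_, ?_⟩
  · rw [pow_mul]
    refine pow_le_pow_left₀ (sq_nonneg _) ?_ q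
    rw [sq_le_sq, abs_of_nonneg (tensorNorm_nonneg A hk P)]
    simpa [blockForm] using abs_le_tensorNorm A hk P hu
  · refine pow_le_pow_left₀ (sq_nonneg _) ?_ q
    rw [le_div_iff₀ (by positivity)]
    exact hB P

lemma exists_blockForm_pow_le (A : (Fin k → Fin N) → ℝ) (hk : 1 ≤ k) (hq : 1 ≤ q) {B : ℝ}
    (hB0 : 0 ≤ B) (hB : ∀ P : Finpartition (Finset.univ : Finset (Fin k)),
      tensorNorm A P ^ 2 * ((2 * q : ℕ) : ℝ) ^ P.parts.card ≤ B) (n : ℕ) :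
    ∀ (R : Finset (Fin k)) (s : Finset (Finset (Fin k))), R.card = n → s.card + n ≤ k →
      (s : Set (Finset (Fin k))).PairwiseDisjoint id → ∅ ∉ s → s.sup id = Rᶜ →
    ∃ Y : (Fin k → Fin N × Fin (2 * q) → Bool) → ℝ, (∀ g, 0 ≤ Y g) ∧
      (∀ g g', (∀ r ∈ R, g r = g' r) → Y g = Y g') ∧
      (∀ u : ∀ J : Finset (Fin k), (↥J → Fin N) → ℝ,
        (∀ J ∈ s, ∑ y, u J y ^ 2 ≤ 1) → ∀ g, blockForm A s R u g ^ (2 * q) ≤ Y g) ∧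
      uexpect Finset.univ Y ≤
        ((12 ^ (k + 1)) ^ n * B / ((2 * q : ℕ) : ℝ) ^ (s.card + n)) ^ q := by
  induction n with
  | zero =>
    intro R s hR _ hs hbot hsup
    rw [Finset.card_eq_zero] at hR
    subst hR
    obtain ⟨Y, hY0, hY, hYB⟩ := exists_blockForm_pow_le_base A hk hq hB s hs hbot
      (by simpa using hsup)
    refine ⟨fun _ => Y, fun _ => hY0, fun _ _ _ => rfl, hY, ?_⟩
    rw [uexpect_const Finset.univ_nonempty]
    simpa using hYB
  | succ n ih =>
    intro R s hR hcard hs hbot hsup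
    obtain ⟨r, hr⟩ : R.Nonempty := Finset.card_pos.1 (by omega)
    have hrs : ∀ J ∈ s, r ∉ J := fun J hJ hrJ => by
      have : r ∈ s.sup id := Finset.mem_sup.2 ⟨J, hJ, hrJ⟩
      rw [hsup] at this
      exact (Finset.mem_compl.1 this) hr
    set K : Finset (Finset (Fin k)) → Finset (Fin k) := fun t => insert r (t.sup id) with hK
    have hKs : ∀ t, K t ∉ s \ t := fun t ht =>
      hrs _ (Finset.mem_sdiff.1 ht).1 (Finset.mem_insert_self _ _)
    have hstep : ∀ t ∈ s.powerset, ∃ Y : (Fin k → Fin N × Fin (2 * q) → Bool) → ℝ,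
        (∀ g, 0 ≤ Y g) ∧ (∀ g g', (∀ r' ∈ R.erase r, g r' = g' r') → Y g = Y g') ∧
        (∀ u : ∀ J : Finset (Fin k), (↥J → Fin N) → ℝ,
          (∀ J ∈ insert (K t) (s \ t), ∑ y, u J y ^ 2 ≤ 1) → ∀ g,
          blockForm A (insert (K t) (s \ t)) (R.erase r) u g ^ (2 * q) ≤ Y g) ∧
        uexpect Finset.univ Y ≤
        ((12 ^ (k + 1)) ^ n * B / ((2 * q : ℕ) : ℝ) ^ ((insert (K t) (s \ t)).card + n)) ^ q := by
      intro t ht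
      have ht' := Finset.mem_powerset.1 ht
      refine ih (R.erase r) _ ?_ ?_ ?_ ?_ ?_
      · rw [Finset.card_erase_of_mem hr, hR, Nat.add_sub_cancel]
      · rw [Finset.card_insert_of_notMem (hKs t)]
        have := Finset.card_le_card (Finset.sdiff_subset (s := s) (t := t))
        omega
      · rw [Finset.coe_insert]
        refine Set.PairwiseDisjoint.insert (hs.subset (by
          exact_mod_cast Finset.sdiff_subset)) fun J hJ _ => ?_
        have hJ' := Finset.mem_sdiff.1 (Finset.mem_coe.1 hJ)
        simp only [id, hK, Finset.disjoint_insert_left]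
        refine ⟨hrs J hJ'.1, ?_⟩
        rw [Finset.disjoint_sup_left]
        intro J₂ hJ₂
        exact hs (ht' hJ₂) hJ'.1 (ne_of_mem_of_not_mem hJ₂ hJ'.2)
      · rw [Finset.mem_insert, not_or]
        exact ⟨(Finset.insert_ne_empty _ _).symm, fun h => hbot (Finset.mem_sdiff.1 h).1⟩
      · rw [Finset.sup_insert, Finset.compl_erase, ← hsup]
        simp only [id, hK]
        conv_rhs => rw [← Finset.union_sdiff_of_subset ht', Finset.sup_union]
        simp [Finset.insert_union]
    choose! Y hY0 hYind hYle hYE using hstep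
    set j := s.card with hj
    set l : ℝ := (12 * 3 ^ j) ^ q with hl
    have hl0 : 0 < l := by positivity
    set E : (Fin k → Fin N × Fin (2 * q) → Bool) → (Fin N × Fin (2 * q) → Bool) → ℝ := fun g γ =>
      uexpect Finset.univ fun ε : ∀ J : Finset (Fin k), (↥J → Fin N) × Fin (2 * q) → Bool =>
        directionSq (contraction (ι := fun J : Finset (Fin k) => ↥J → Fin N) s
          (weightedTensor A (R.erase r) g) blockIndex (fun idx => idx r)
          fun J => signMean (ε J)) (signMean γ) ^ (2 * q) with hE
    have hE0 : ∀ g γ, 0 ≤ E g γ := fun g γ =>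
      uexpect_nonneg fun ε _ => pow_nonneg (directionSq_nonneg _ _) _
    have hEγ : ∀ g, (uexpect Finset.univ fun γ => E g γ) ≤ 12 ^ (2 * q) := fun g => by
      simp only [hE]
      rw [uexpect_comm, ← uexpect_const (Ω := (Finset.univ : Finset
        (∀ J : Finset (Fin k), (↥J → Fin N) × Fin (2 * q) → Bool))) Finset.univ_nonempty
        ((12 : ℝ) ^ (2 * q))]
      exact uexpect_mono fun ε _ => uexpect_directionSq_pow_le hq _
    have hwt : ∀ g g' : Fin k → Fin N × Fin (2 * q) → Bool, (∀ r' ∈ R.erase r, g r' = g' r') →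
        weightedTensor A (R.erase r) g = weightedTensor A (R.erase r) g' := fun g g' h => by
      ext idx
      rw [weightedTensor, weightedTensor, Finset.prod_congr rfl fun r' hr' => by rw [h r' hr']]
    set Z : (Fin k → Fin N × Fin (2 * q) → Bool) → (Fin N × Fin (2 * q) → Bool) → ℝ := fun g γ =>
      (((9 : ℝ) ^ j) ^ q / l * E g γ + l) / 2 with hZ
    have hZ0 : ∀ g γ, 0 ≤ Z g γ := fun g γ => by
      have := hE0 g γ
      simp only [hZ]
      positivity
    have hEind : ∀ g g', (∀ r' ∈ R.erase r, g r' = g' r') → E g = E g' := fun g g' h => by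
      simp only [hE, hwt g g' h]
    have hZind : ∀ g g', (∀ r' ∈ R.erase r, g r' = g' r') → Z g = Z g' := fun g g' h => by
      simp only [hZ, hEind g g' h]
    have hZγ : ∀ g, (uexpect Finset.univ fun γ => Z g γ) ≤ l := fun g => by
      have hll : l * l = ((9 : ℝ) ^ j) ^ q * 12 ^ (2 * q) := by
        rw [hl, pow_mul, ← mul_pow, ← mul_pow]
        congr 1
        rw [show (9 : ℝ) = 3 * 3 by norm_num, mul_pow]
        ring
      have e : (uexpect Finset.univ fun γ => Z g γ) =
          (((9 : ℝ) ^ j) ^ q / l * (uexpect Finset.univ fun γ => E g γ) + l) / 2 := by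
        simp only [hZ, div_eq_mul_inv _ (2 : ℝ)]
        rw [uexpect_mul_const, uexpect_add, uexpect_const_mul, uexpect_const Finset.univ_nonempty]
      rw [e]
      have h2 : ((9 : ℝ) ^ j) ^ q / l * (uexpect Finset.univ fun γ => E g γ) ≤ l := by
        refine (mul_le_mul_of_nonneg_left (hEγ g) (by positivity)).trans ?_
        rw [div_mul_eq_mul_div, ← hll, mul_div_cancel_right₀ _ hl0.ne']
      linarith
    set p : ℝ := ((2 * q : ℕ) : ℝ) with hp
    have hp0 : 0 < p := by
      rw [hp]
      positivity
    have hupd : ∀ (g : Fin k → Fin N × Fin (2 * q) → Bool) (γ), ∀ r' ∈ R.erase r,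
        Function.update g r γ r' = g r' := fun g γ r' hr' =>
      Function.update_of_ne (Finset.ne_of_mem_erase hr') _ _
    refine ⟨fun g => ((2 : ℝ) ^ j) ^ q * (∑ t ∈ s.powerset, (p⁻¹ ^ t.card) ^ q * Y t g) *
      Z g (g r), fun g => ?_, fun g g' h => ?_, fun u hu g => ?_, ?_⟩
    · refine mul_nonneg (mul_nonneg (by positivity) (Finset.sum_nonneg fun t ht =>
        mul_nonneg (by positivity) (hY0 t ht g))) (hZ0 _ _)
    · have h' : ∀ r' ∈ R.erase r, g r' = g' r' := fun r' hr' => h r' (Finset.mem_of_mem_erase hr')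
      beta_reduce
      rw [hZind g g' h', h r hr, Finset.sum_congr rfl fun t ht => by rw [hYind t ht g g' h']]
    · rw [blockForm_eq_sum_contraction A s hr]
      refine (sum_contraction_mul_pow_le hq (weightedTensor A (R.erase r) g) blockIndex
        (fun idx => idx r) (s := s) (ι := fun J : Finset (Fin k) => ↥J → Fin N) hu
        (ζ := fun t => ↥(K t) → Fin N)
        (fun t idx => blockIndex idx (K t)) ?_ (signMean (g r))).trans ?_
      · intro t _ idx idx'
        simp only [blockIndex, funext_iff, Subtype.forall, hK, Finset.mem_insert, Finset.mem_sup,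
          id, forall_eq_or_imp, forall_exists_index, and_imp]
        exact and_congr_right fun _ =>
          ⟨fun h J hJ m hm => h m J hJ hm, fun h m J hJ hm => h J hJ m hm⟩
      · refine mul_le_mul_of_nonneg_right ?_ (hZ0 g (g r))
        refine (sum_pow_le_card_pow_mul _ (fun t _ => mul_nonneg (by positivity)
          (Finset.sum_nonneg fun _ _ => sq_nonneg _)) q ⟨∅, Finset.empty_mem_powerset _⟩).trans ?_
        rw [Finset.card_powerset]
        push_cast
        refine mul_le_mul_of_nonneg_left (Finset.sum_le_sum fun t ht => ?_) (by positivity)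
        rw [mul_pow]
        have hpe : (2 * (q : ℝ)) = p := by rw [hp]; push_cast; rfl
        rw [hpe]
        refine mul_le_mul_of_nonneg_left ?_ (by positivity)
        refine sum_sq_pow_le_of_forall _ hq (hY0 t ht g) fun v hv => ?_
        rw [sum_contraction_mul_eq_blockForm A (s \ t) _ (K t) (hKs t)]
        refine hYle t ht _ (fun J hJ => ?_) g
        rcases Finset.mem_insert.1 hJ with h | h
        · subst h
          simpa using hv
        · rw [Function.update_of_ne (ne_of_mem_of_not_mem h (hKs t))]
          exact hu J (Finset.mem_sdiff.1 h).1
    · have h1 : (uexpect Finset.univ fun g => ((2 : ℝ) ^ j) ^ q *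
          (∑ t ∈ s.powerset, (p⁻¹ ^ t.card) ^ q * Y t g) * Z g (g r)) ≤
          ((2 : ℝ) ^ j) ^ q * l * ∑ t ∈ s.powerset, (p⁻¹ ^ t.card) ^ q *
            uexpect Finset.univ (Y t) := by
        rw [uexpect_update r]
        have e : ((2 : ℝ) ^ j) ^ q * l * ∑ t ∈ s.powerset, (p⁻¹ ^ t.card) ^ q *
            uexpect Finset.univ (Y t) = uexpect Finset.univ fun g => ((2 : ℝ) ^ j) ^ q *
          (∑ t ∈ s.powerset, (p⁻¹ ^ t.card) ^ q * Y t g) * l := by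
          rw [uexpect_mul_const, uexpect_const_mul, uexpect_sum]
          simp only [uexpect_const_mul]
          ring
        rw [e]
        refine uexpect_mono fun g _ => ?_
        have e2 : ∀ γ, ((2 : ℝ) ^ j) ^ q * (∑ t ∈ s.powerset, (p⁻¹ ^ t.card) ^ q *
            Y t (Function.update g r γ)) * Z (Function.update g r γ) (Function.update g r γ r) =
            ((2 : ℝ) ^ j) ^ q * (∑ t ∈ s.powerset, (p⁻¹ ^ t.card) ^ q * Y t g) * Z g γ := fun γ => by
          rw [Function.update_self, hZind _ g (hupd g γ), Finset.sum_congr rfl fun t ht => by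
            rw [hYind t ht _ g (hupd g γ)]]
        rw [uexpect_congr fun γ _ => e2 γ, uexpect_const_mul]
        exact mul_le_mul_of_nonneg_left (hZγ g) (mul_nonneg (by positivity)
          (Finset.sum_nonneg fun t ht => mul_nonneg (by positivity) (hY0 t ht g)))
      refine h1.trans ?_
      set C : ℝ := (12 ^ (k + 1)) ^ n * B / p ^ (j + (n + 1)) with hC
      have hC0 : 0 ≤ C := by positivity
      have h2 : ∀ t ∈ s.powerset, (p⁻¹ ^ t.card) ^ q * uexpect Finset.univ (Y t) ≤ C ^ q := by
        intro t ht
        refine (mul_le_mul_of_nonneg_left (hYE t ht) (by positivity)).trans ?_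
        rw [← mul_pow]
        refine pow_le_pow_left₀ (by positivity) (le_of_eq ?_) q
        have hc : t.card + ((insert (K t) (s \ t)).card + n) = j + (n + 1) := by
          rw [Finset.card_insert_of_notMem (hKs t)]
          have := Finset.card_sdiff_add_card_eq_card (Finset.mem_powerset.1 ht)
          omega
        rw [hC, ← hc, pow_add p t.card, inv_pow]
        field_simp
      have h3 := Finset.sum_le_card_nsmul _ _ _ h2
      rw [Finset.card_powerset, nsmul_eq_mul] at h3
      push_cast at h3
      have hjk : j ≤ k := by omega
      calc ((2 : ℝ) ^ j) ^ q * l * ∑ t ∈ s.powerset, (p⁻¹ ^ t.card) ^ q * uexpect Finset.univ (Y t)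
          ≤ ((2 : ℝ) ^ j) ^ q * l * (2 ^ j * C ^ q) := by gcongr
        _ ≤ ((2 : ℝ) ^ j) ^ q * l * ((2 ^ j) ^ q * C ^ q) := by
            gcongr
            exact le_self_pow₀ (one_le_pow₀ (by norm_num)) (by omega)
        _ = (12 * 12 ^ j * C) ^ q := by
            rw [hl, ← mul_pow, ← mul_pow, ← mul_pow]
            congr 1
            rw [show (12 : ℝ) ^ j = 2 ^ j * 3 ^ j * 2 ^ j by rw [← mul_pow, ← mul_pow]; norm_num]
            ring
        _ ≤ (12 ^ (k + 1) * C) ^ q := by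
            gcongr
            rw [pow_succ, mul_comm]
            gcongr
            norm_num
        _ = _ := by
            rw [hC, pow_succ (12 ^ (k + 1) : ℝ) n]
            congr 1
            ring

/-- Moments of a chaos of order `k` are controlled by the tensor norms of its coefficients. -/
lemma uexpect_tensorApply_pow_le (A : (Fin k → Fin N) → ℝ) (hk : 1 ≤ k) (hq : 1 ≤ q) {B : ℝ}
    (hB0 : 0 ≤ B) (hB : ∀ P : Finpartition (Finset.univ : Finset (Fin k)),
      tensorNorm A P ^ 2 * ((2 * q : ℕ) : ℝ) ^ P.parts.card ≤ B) :
    (uexpect Finset.univ fun g : Fin k → Fin N × Fin (2 * q) → Bool =>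
      tensorApply A (fun j => signMean (g j)) ^ (2 * q)) ≤
      ((12 ^ (k + 1)) ^ k * B / ((2 * q : ℕ) : ℝ) ^ k) ^ q := by
  obtain ⟨Y, -, -, hY, hYE⟩ := exists_blockForm_pow_le A hk hq hB0 hB k Finset.univ ∅
    (by simp) (by simp) (by simp) (by simp) (by simp)
  refine (uexpect_mono fun g _ => ?_).trans (hYE.trans (le_of_eq ?_))
  · simpa [blockForm, tensorApply] using hY (fun _ _ => 0) (by simp) g
  · simp

end ChaosBound

section TailBound

variable {L N : ℕ} {κ : Fin L → ℕ} {x : Fin L → ℝ}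

lemma uprob_le_one {α : Type*} (Ω : Finset α) (r : α → Prop) : uprob Ω r ≤ 1 := by
  unfold uprob
  refine div_le_one_of_le₀ ?_ (Nat.cast_nonneg _)
  exact_mod_cast Finset.card_le_card (Finset.filter_subset _ _)

lemma uprob_mul_pow_le {α : Type*} (Ω : Finset α) (F : α → ℝ) {t : ℝ} (ht : 0 ≤ t) (q : ℕ) :
    uprob Ω (fun ω => |F ω| ≥ t) * t ^ (2 * q) ≤ uexpect Ω fun ω => F ω ^ (2 * q) := by
  unfold uprob uexpect
  rw [div_mul_eq_mul_div]
  refine div_le_div_of_nonneg_right ?_ (Nat.cast_nonneg _)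
  rw [← nsmul_eq_mul]
  refine (Finset.card_nsmul_le_sum _ (fun ω => F ω ^ (2 * q)) _ fun ω hω => ?_).trans
    (Finset.sum_le_sum_of_subset_of_nonneg (Finset.filter_subset _ _) fun ω _ _ => ?_)
  · have h := (Finset.mem_filter.1 hω).2
    calc t ^ (2 * q) ≤ |F ω| ^ (2 * q) := pow_le_pow_left₀ ht h _
      _ = F ω ^ (2 * q) := by rw [pow_mul, sq_abs, pow_mul]
  · rw [pow_mul]
    positivity

/-- The constant in front of the moment bound for polynomials of degree `d`. -/
def momentConst (d : ℕ) : ℝ := 2 * d * 4000 ^ d * (12 ^ (d + 1)) ^ d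

lemma centered_moment_le_of_tensorNorm_le (hM : (multislice L N κ x).Nonempty) {X : ℝ}
    (hX0 : 0 < X) (hX : ∀ i j, |x i - x j| ≤ X) {q : ℕ} (hq : 1 ≤ q) {d : ℕ} (hd : 1 ≤ d)
    {a : Finset (Fin N) → ℝ} (ha : ∀ S, d + 1 ≤ S.card → a S = 0) {T : ℝ} (hT : 0 ≤ T)
    (hB : ∀ k, 1 ≤ k → k ≤ d → ∀ P : Finpartition (Finset.univ : Finset (Fin k)),
      tensorNorm (fun idx => uexpect (multislice L N κ x) fun ω => mlDeriv a k ω idx) P ^ 2 *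
        ((2 * q : ℕ) : ℝ) ^ P.parts.card ≤ T / (X ^ 2) ^ k) :
    (uexpect (multislice L N κ x) fun ω =>
        (mlPoly a ω - uexpect (multislice L N κ x) (mlPoly a)) ^ (2 * q)) ≤
      (momentConst d * T) ^ q := by
  refine (centered_moment_le_sum_chaosMoment hM hX hq d a ha).trans ?_
  have hq0 : (0 : ℝ) < q := by exact_mod_cast hq
  have hd0 : (1 : ℝ) ≤ d := by exact_mod_cast hd
  set Q : ℝ := (500 ^ d * (12 ^ (d + 1)) ^ d * T) ^ q with hQ
  have hterm : ∀ k ∈ Finset.range d, ((1000 * (q : ℝ) * X ^ 2) ^ q) ^ (k + 1) *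
      chaosMoment (multislice L N κ x) q (k + 1) a ≤ Q := by
    intro k hk
    have hk' : k + 1 ≤ d := Finset.mem_range.1 hk
    have h := uexpect_tensorApply_pow_le _ (Nat.le_add_left 1 k) hq
      (div_nonneg hT (by positivity)) (hB (k + 1) (Nat.le_add_left 1 k) hk')
    refine (mul_le_mul_of_nonneg_left h (by positivity)).trans ?_
    rw [← pow_mul, mul_comm q, pow_mul, ← mul_pow]
    refine pow_le_pow_left₀ (by positivity) ?_ q
    have e : (1000 * (q : ℝ) * X ^ 2) ^ (k + 1) *
        ((12 ^ (k + 1 + 1)) ^ (k + 1) * (T / (X ^ 2) ^ (k + 1)) / ((2 * q : ℕ) : ℝ) ^ (k + 1)) =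
        500 ^ (k + 1) * (12 ^ (k + 1 + 1)) ^ (k + 1) * T := by
      rw [show (1000 * (q : ℝ) * X ^ 2) = 500 * ((2 * q : ℕ) : ℝ) * X ^ 2 by push_cast; ring,
        mul_pow, mul_pow]
      field_simp
    rw [e]
    have h1 : (500 : ℝ) ^ (k + 1) ≤ 500 ^ d := pow_le_pow_right₀ (by norm_num) hk'
    have h2 : ((12 : ℝ) ^ (k + 1 + 1)) ^ (k + 1) ≤ (12 ^ (d + 1)) ^ d := by
      rw [← pow_mul, ← pow_mul]
      exact pow_le_pow_right₀ (by norm_num) (Nat.mul_le_mul (by omega) hk')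
    gcongr
  have hsum := Finset.sum_le_card_nsmul _ _ _ hterm
  rw [Finset.card_range, nsmul_eq_mul] at hsum
  calc _ ≤ 2 * (8 : ℝ) ^ (q * d) * (d * Q) := by gcongr
    _ = (2 * d) * ((8 ^ d) ^ q * Q) := by
        rw [← pow_mul, mul_comm d q]
        ring
    _ ≤ (2 * d) ^ q * ((8 ^ d) ^ q * Q) := by
        gcongr
        exact le_self_pow₀ (by linarith) (by omega)
    _ = _ := by
        rw [hQ, ← mul_pow, ← mul_pow]
        congr 1
        rw [momentConst, show (4000 : ℝ) = 8 * 500 by norm_num, mul_pow]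
        ring

lemma rpow_le_pow_of_le {m τ : ℝ} (hm : 0 < m) (hτ : 0 ≤ τ) {l : ℕ} (hl : l ≠ 0)
    (h : m ≤ τ ^ ((2 : ℝ) / l)) : m ^ l ≤ τ ^ 2 := by
  have hl' : (l : ℝ) ≠ 0 := by exact_mod_cast hl
  calc m ^ l ≤ (τ ^ ((2 : ℝ) / l)) ^ l := pow_le_pow_left₀ hm.le h l
    _ = τ ^ 2 := by
      rw [← Real.rpow_natCast, ← Real.rpow_mul hτ, div_mul_cancel₀ _ hl']
      exact_mod_cast Real.rpow_natCast τ 2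

lemma norm_sq_mul_pow_le {m t X n : ℝ} (hm : 0 < m) (ht : 0 ≤ t) (hX : 0 < X) (hn : 0 ≤ n)
    {k l : ℕ} (hl : l ≠ 0) (h : m ≤ (t / (X ^ k * n)) ^ ((2 : ℝ) / l)) :
    0 < t ∧ n ^ 2 * m ^ l ≤ t ^ 2 / (X ^ 2) ^ k := by
  have h1 := rpow_le_pow_of_le hm (div_nonneg ht (by positivity)) hl h
  have h2 : 0 < (t / (X ^ k * n)) ^ 2 := (pow_pos hm l).trans_le h1
  have h3 : t / (X ^ k * n) ≠ 0 := fun h0 => by simp [h0] at h2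
  have h4 : t ≠ 0 := fun h0 => h3 (by simp [h0])
  have h5 : n ≠ 0 := fun h0 => h3 (by simp [h0])
  refine ⟨lt_of_le_of_ne ht h4.symm, ?_⟩
  calc n ^ 2 * m ^ l ≤ n ^ 2 * (t / (X ^ k * n)) ^ 2 := by gcongr
    _ = t ^ 2 / (X ^ 2) ^ k := by
      rw [← pow_mul, mul_comm 2 k, pow_mul]
      field_simp

lemma one_le_two_mul_exp {y : ℝ} (hy : y ≤ 1 / 2) : 1 ≤ 2 * Real.exp (-y) := by
  have := Real.add_one_le_exp (-y)
  linarith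

lemma tail_le_of_pow_le (hM : (multislice L N κ x).Nonempty) {X : ℝ}
    (hX0 : 0 < X) (hX : ∀ i j, |x i - x j| ≤ X) {d : ℕ} (hd : 1 ≤ d)
    {a : Finset (Fin N) → ℝ} (ha : ∀ S, d + 1 ≤ S.card → a S = 0) {t m : ℝ} (ht : 0 < t)
    (hm : 2 ≤ m / (8 * momentConst d))
    (hB : ∀ k, 1 ≤ k → k ≤ d → ∀ P : Finpartition (Finset.univ : Finset (Fin k)),
      tensorNorm (fun idx => uexpect (multislice L N κ x) fun ω => mlDeriv a k ω idx) P ^ 2 *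
        m ^ P.parts.card ≤ t ^ 2 / (X ^ 2) ^ k) :
    uprob (multislice L N κ x)
        (fun ω => |mlPoly a ω - uexpect (multislice L N κ x) (mlPoly a)| ≥ t) ≤
      Real.exp (-(m / (8 * momentConst d) / 2)) := by
  have hC1 : 1 ≤ momentConst d := by
    have hd0 : (1 : ℝ) ≤ d := by exact_mod_cast hd
    have h1 : (1 : ℝ) ≤ 4000 ^ d := one_le_pow₀ (by norm_num)
    have h2 : (1 : ℝ) ≤ (12 ^ (d + 1)) ^ d := one_le_pow₀ (one_le_pow₀ (by norm_num))
    unfold momentConst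
    exact one_le_mul_of_one_le_of_one_le
      (one_le_mul_of_one_le_of_one_le (by linarith) h1) h2
  set C := momentConst d with hC
  set y := m / (8 * C) with hy
  have hmy : m = 8 * C * y := by
    rw [hy]
    field_simp
  have hm0 : 0 < m := by
    rw [hmy]
    positivity
  set q := ⌊y / 2⌋₊ with hqdef
  have hq : 1 ≤ q := Nat.le_floor (by push_cast; linarith)
  have hqy : (q : ℝ) ≤ y / 2 := Nat.floor_le (by linarith)
  have hyq : y / 2 < q + 1 := Nat.lt_floor_add_one _
  have hq1 : (1 : ℝ) ≤ q := by exact_mod_cast hq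
  have hmom := centered_moment_le_of_tensorNorm_le hM hX0 hX hq hd ha (T := t ^ 2 / (8 * C))
    (by positivity) fun k hk hkd P => by
      have hl : P.parts.card ≠ 0 := by
        have hne : P.parts.Nonempty := P.parts_nonempty (by
          have : (Finset.univ : Finset (Fin k)).Nonempty := ⟨⟨0, hk⟩, Finset.mem_univ _⟩
          exact this.ne_empty)
        exact hne.card_pos.ne'
      have h1 : ((2 * q : ℕ) : ℝ) ≤ (8 * C)⁻¹ * m := by
        rw [hmy, inv_mul_cancel_left₀ (by positivity)]
        push_cast
        linarith
      have h2 : ((2 * q : ℕ) : ℝ) ^ P.parts.card ≤ (8 * C)⁻¹ * m ^ P.parts.card := by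
        refine (pow_le_pow_left₀ (Nat.cast_nonneg _) h1 _).trans ?_
        rw [mul_pow]
        refine mul_le_mul_of_nonneg_right ?_ (by positivity)
        exact pow_le_of_le_one (by positivity) (inv_le_one_of_one_le₀ (by linarith)) hl
      calc _ ≤ _ := mul_le_mul_of_nonneg_left h2 (sq_nonneg _)
        _ = (8 * C)⁻¹ * _ := mul_left_comm _ _ _
        _ ≤ (8 * C)⁻¹ * _ := mul_le_mul_of_nonneg_left (hB k hk hkd P) (by positivity)
        _ = _ := by
          field_simp
  have hmark := (uprob_mul_pow_le (multislice L N κ x)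
    (fun ω => mlPoly a ω - uexpect (multislice L N κ x) (mlPoly a)) ht.le q).trans hmom
  rw [← hC, show C * (t ^ 2 / (8 * C)) = 8⁻¹ * t ^ 2 by field_simp, mul_pow, ← pow_mul] at hmark
  have h8 := le_of_mul_le_mul_right hmark (by positivity)
  refine h8.trans ?_
  have he : (8 : ℝ)⁻¹ ≤ Real.exp (-2) := by
    rw [Real.exp_neg]
    refine inv_anti₀ (Real.exp_pos _) ?_
    have h : Real.exp 2 = Real.exp 1 ^ 2 := by rw [← Real.exp_nat_mul]; norm_num
    rw [h]
    have := Real.exp_one_lt_d9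
    have h0 := Real.exp_pos 1
    nlinarith
  refine (pow_le_pow_left₀ (by norm_num) he q).trans ?_
  rw [← Real.exp_nat_mul]
  exact Real.exp_le_exp.2 (by linarith)

end TailBound

/-- Multilevel tail inequality for multilinear polynomials on the multislice. -/
theorem stmt2 (d : ℕ) (hd : 1 ≤ d) :
    ∃ c : ℝ, 0 < c ∧
      ∀ (L N : ℕ) (hL : 2 ≤ L) (κ : Fin L → ℕ) (hκ : ∀ ℓ, 1 ≤ κ ℓ)
        (hN : N = ∑ ℓ, κ ℓ) (x : Fin L → ℝ) (hx : StrictMono x)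
        (a : Finset (Fin N) → ℝ) (ha : ∀ S : Finset (Fin N), d < S.card → a S = 0)
        (t : ℝ) (ht : 0 ≤ t),
        uprob (multislice L N κ x)
            (fun ω => |mlPoly a ω - uexpect (multislice L N κ x) (mlPoly a)| ≥ t) ≤
          2 * Real.exp (-c * sInf { m : ℝ | ∃ k : ℕ, 1 ≤ k ∧ k ≤ d ∧
            ∃ P : Finpartition (Finset.univ : Finset (Fin k)),
              m = (t / ((x ⟨L - 1, by omega⟩ - x ⟨0, by omega⟩) ^ k *
                    tensorNorm (fun idx => uexpect (multislice L N κ x)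
                      (fun ω => mlDeriv a k ω idx)) P)) ^ ((2 : ℝ) / P.parts.card) }) := by
  have hC : 0 < momentConst d := by
    have : (1 : ℝ) ≤ d := by exact_mod_cast hd
    unfold momentConst
    positivity
  refine ⟨1 / (8 * momentConst d) / 4, by positivity, ?_⟩
  intro L N hL κ _ _ x hx a ha t ht
  set M := multislice L N κ x with hMdef
  set X := x ⟨L - 1, by omega⟩ - x ⟨0, by omega⟩ with hXdef
  have hX0 : 0 < X := sub_pos.2 (hx (Fin.mk_lt_mk.2 (by omega)))
  have hX : ∀ i j, |x i - x j| ≤ X := fun i j => by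
    have h1 : ∀ i, x ⟨0, by omega⟩ ≤ x i := fun i =>
      hx.monotone (Fin.mk_le_of_le_val (Nat.zero_le _))
    have h2 : ∀ i : Fin L, x i ≤ x ⟨L - 1, by omega⟩ := fun i =>
      hx.monotone (Fin.le_iff_val_le_val.2 (by simp only; omega))
    rw [abs_le]
    constructor <;> linarith [h1 i, h1 j, h2 i, h2 j]
  set V := { m : ℝ | ∃ k : ℕ, 1 ≤ k ∧ k ≤ d ∧
            ∃ P : Finpartition (Finset.univ : Finset (Fin k)),
              m = (t / (X ^ k * tensorNorm (fun idx => uexpect M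
                      (fun ω => mlDeriv a k ω idx)) P)) ^ ((2 : ℝ) / P.parts.card) } with hV
  set m := sInf V with hm
  rw [show -(1 / (8 * momentConst d) / 4) * m = -(m / (8 * momentConst d) / 4) by ring]
  rcases M.eq_empty_or_nonempty with hM | hM
  · rw [hM]
    simp only [uprob, Finset.filter_empty, Finset.card_empty, Nat.cast_zero, zero_div]
    positivity
  by_cases hsmall : m / (8 * momentConst d) / 4 ≤ 1 / 2
  · exact (uprob_le_one _ _).trans (one_le_two_mul_exp hsmall)
  have hbig : 2 ≤ m / (8 * momentConst d) := by linarith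
  have hm0 : 0 < m := by
    rw [le_div_iff₀ (by positivity)] at hbig
    linarith
  have hbdd : BddBelow V := by
    refine ⟨0, ?_⟩
    rintro _ ⟨k, hk, -, P, rfl⟩
    exact Real.rpow_nonneg (div_nonneg ht (mul_nonneg (by positivity) (tensorNorm_nonneg _ hk P))) _
  have hkey : ∀ k, 1 ≤ k → k ≤ d → ∀ P : Finpartition (Finset.univ : Finset (Fin k)),
      0 < t ∧ tensorNorm (fun idx => uexpect M fun ω => mlDeriv a k ω idx) P ^ 2 *
        m ^ P.parts.card ≤ t ^ 2 / (X ^ 2) ^ k := fun k hk hkd P => by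
    have hne : P.parts.Nonempty := P.parts_nonempty (by
      have : (Finset.univ : Finset (Fin k)).Nonempty := ⟨⟨0, hk⟩, Finset.mem_univ _⟩
      exact this.ne_empty)
    exact norm_sq_mul_pow_le hm0 ht hX0 (tensorNorm_nonneg _ hk P) hne.card_pos.ne'
      (csInf_le hbdd ⟨k, hk, hkd, P, rfl⟩)
  have ht0 : 0 < t := (hkey 1 le_rfl hd ⊥).1
  refine (tail_le_of_pow_le hM hX0 hX hd (fun S hS => ha S hS) ht0 hbig
    fun k hk hkd P => (hkey k hk hkd P).2).trans ?_
  have h1 : Real.exp (-(m / (8 * momentConst d) / 2)) ≤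
      Real.exp (-(m / (8 * momentConst d) / 4)) :=
    Real.exp_le_exp.2 (by linarith)
  have h2 := Real.exp_pos (-(m / (8 * momentConst d) / 4))
  linarith
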